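/- arXiv:2409.03047 — 3 statements merged into one kernel-verified Lean document; each statement's English description precedes it below -/
import Mathlib

section
/- Let p > 0, let 𝒮_p ⊆ ℝ³ be the polynomial spiral shell, and let S_p := ⋃_{j=1}^∞ S(0, j^{−p}) ⊆ ℝ³ be the union of the Euclidean spheres centered at 0 of radii j^{−p}. Then for every θ ∈ (0,1), dim_A^θ 𝒮_p = dim_A^θ S_p. -/
open Metric Set Filter MeasureTheory Topology
open scoped RealInnerProductSpace

noncomputable section

/-- `d`-dimensional Euclidean space. -/
abbrev Euc (d : ℕ) : Type := EuclideanSpace ℝ (Fin d)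

/-- The number of cubes in the axes-oriented `r`-mesh of `ℝ^d` that intersect `E`;
for nonempty bounded `E` this is the box-counting number `N_r(E)`. -/
def meshCubeCount (d : ℕ) (r : ℝ) (E : Set (Euc d)) : ℕ :=
  Set.ncard {k : Fin d → ℤ | ∃ x ∈ E, ∀ i, (k i : ℝ) * r ≤ x i ∧ x i < ((k i : ℝ) + 1) * r}

/-- The lower box dimension `liminf_{r → 0⁺} log N_r(E) / (- log r)`. -/
def lowerBoxDim (d : ℕ) (E : Set (Euc d)) : ℝ :=
  liminf (fun r : ℝ => Real.log (meshCubeCount d r E : ℝ) / -Real.log r) (𝓝[>] (0 : ℝ))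

/-- The upper box dimension `limsup_{r → 0⁺} log N_r(E) / (- log r)`. -/
def upperBoxDim (d : ℕ) (E : Set (Euc d)) : ℝ :=
  limsup (fun r : ℝ => Real.log (meshCubeCount d r E : ℝ) / -Real.log r) (𝓝[>] (0 : ℝ))

/-- The box dimension of `E` exists and equals `v`. -/
def HasBoxDim (d : ℕ) (E : Set (Euc d)) (v : ℝ) : Prop :=
  lowerBoxDim d E = v ∧ upperBoxDim d E = v

/-- The `θ`-Assouad spectrum of `E ⊆ ℝ^d`. -/
def assouadSpec (d : ℕ) (θ : ℝ) (E : Set (Euc d)) : ℝ :=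
  sInf {α : ℝ | 0 < α ∧ ∃ C : ℝ, 0 < C ∧ ∀ r : ℝ, 0 < r → r < 1 → ∀ x ∈ E,
    (meshCubeCount d r (ball x (r ^ θ) ∩ E) : ℝ) ≤ C * (r ^ (θ - 1)) ^ α}

/-- The regularized (upper) `θ`-Assouad spectrum of `E ⊆ ℝ^d`. -/
def regAssouadSpec (d : ℕ) (θ : ℝ) (E : Set (Euc d)) : ℝ :=
  sInf {α : ℝ | 0 < α ∧ ∃ C : ℝ, 0 < C ∧ ∀ r R : ℝ, 0 < r → 0 < R → r ≤ R ^ (1 / θ) → R < 1 →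
    ∀ x ∈ E, (meshCubeCount d r (ball x R ∩ E) : ℝ) ≤ C * (R / r) ^ α}

/-- The Assouad dimension of `E ⊆ ℝ^d`. -/
def assouadDim (d : ℕ) (E : Set (Euc d)) : ℝ :=
  sInf {α : ℝ | 0 < α ∧ ∃ C : ℝ, 0 < C ∧ ∀ r R : ℝ, 0 < r → r ≤ R → ∀ x ∈ E,
    (meshCubeCount d r (ball x R ∩ E) : ℝ) ≤ C * (R / r) ^ α}

/-- The (Euclidean) distance between two sets. -/
def setDistance {d : ℕ} (A B : Set (Euc d)) : ℝ :=
  sInf (Set.image2 dist A B)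

/-- `S ⊆ ℝ^d` is a topological sphere: the image of the unit sphere under a
self-homeomorphism of `ℝ^d`. -/
def IsTopologicalSphere (d : ℕ) (S : Set (Euc d)) : Prop :=
  ∃ f : Euc d ≃ₜ Euc d, S = f '' sphere (0 : Euc d) 1

/-- `g` is a similarity of `ℝ^d` with similarity ratio `c`, i.e. `g x = c • A x + t`
with `c > 0`, `A` orthogonal and `t ∈ ℝ^d`. -/
def IsSimilarityRatio {d : ℕ} (g : Euc d → Euc d) (c : ℝ) : Prop :=
  0 < c ∧ ∃ A : Euc d ≃ₗᵢ[ℝ] Euc d, ∃ t : Euc d, ∀ x, g x = c • A x + t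

/-- `g` is a similarity map of `ℝ^d`. -/
def IsSimilarity {d : ℕ} (g : Euc d → Euc d) : Prop :=
  ∃ c : ℝ, IsSimilarityRatio g c

/-- `S` is a concentric sphere collection centered at `x₀` and generated by the
topological sphere `S₀`. -/
def IsConcentricSphereColl (d : ℕ) (x₀ : Euc d) (S₀ S : Set (Euc d)) : Prop :=
  ∃ f : Euc d ≃ₜ Euc d, S₀ = f '' sphere (0 : Euc d) 1 ∧ x₀ ∈ f '' ball (0 : Euc d) 1 ∧
    ∃ g : ℕ → Euc d → Euc d, g 0 = id ∧ (∀ n, IsSimilarity (g n)) ∧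
      S = (⋃ n : ℕ, g n '' S₀) ∧
      ∃ c₁ c₂ : ℝ, ∃ n₀ : ℕ, ∃ a : ℕ → ℝ,
        c₁ ∈ Ioc (0 : ℝ) 1 ∧ c₂ ∈ Ioc (0 : ℝ) 1 ∧ 1 ≤ n₀ ∧
        StrictAnti a ∧ Tendsto a atTop (𝓝 (0 : ℝ)) ∧
        ∀ n : ℕ, n₀ ≤ n →
          hausdorffDist (g n '' S₀) {x₀} = c₁ * a n ∧
          setDistance (g n '' S₀) (g (n + 1) '' S₀) = c₂ * (a n - a (n + 1))

/-- `S` is a `p`-polynomially concentric sphere collection centered at `x₀` and generated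
by the topological sphere `S₀` (the defining sequence is `a n = n ^ (-p)`). -/
def IsPConcentricSphereColl (d : ℕ) (p : ℝ) (x₀ : Euc d) (S₀ S : Set (Euc d)) : Prop :=
  ∃ f : Euc d ≃ₜ Euc d, S₀ = f '' sphere (0 : Euc d) 1 ∧ x₀ ∈ f '' ball (0 : Euc d) 1 ∧
    ∃ g : ℕ → Euc d → Euc d, g 0 = id ∧ (∀ n, IsSimilarity (g n)) ∧
      S = (⋃ n : ℕ, g n '' S₀) ∧
      ∃ c₁ c₂ : ℝ, ∃ n₀ : ℕ, ∃ a : ℕ → ℝ,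
        c₁ ∈ Ioc (0 : ℝ) 1 ∧ c₂ ∈ Ioc (0 : ℝ) 1 ∧ 1 ≤ n₀ ∧
        StrictAnti a ∧ Tendsto a atTop (𝓝 (0 : ℝ)) ∧
        (∀ n : ℕ, n₀ ≤ n → a n = (n : ℝ) ^ (-p)) ∧
        ∀ n : ℕ, n₀ ≤ n →
          hausdorffDist (g n '' S₀) {x₀} = c₁ * a n ∧
          setDistance (g n '' S₀) (g (n + 1) '' S₀) = c₂ * (a n - a (n + 1))

/-- The polynomial spiral shell `𝒮_p ⊆ ℝ³`. -/
def spiralShell (p : ℝ) : Set (Euc 3) :=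
  {x : Euc 3 | ∃ u v : ℝ, 1 ≤ u ∧ 1 ≤ v ∧
    x = (WithLp.equiv 2 (Fin 3 → ℝ)).symm
      ![u ^ (-p) * Real.cos u * Real.sin v,
        u ^ (-p) * Real.sin u * Real.sin v,
        u ^ (-p) * Real.cos v]}

/-- The union `⋃_{j ≥ 1} S(0, j^{-p})` of concentric round spheres in `ℝ³`. -/
def sphereUnion (p : ℝ) : Set (Euc 3) :=
  ⋃ j : ℕ, sphere (0 : Euc 3) (((j : ℝ) + 1) ^ (-p))

/-- `F : ℝ³ → ℝ³` is `K`-quasiconformal: `F` lies in the local Sobolev space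
`W^{1,3}_loc(ℝ³; ℝ³)`, witnessed by a weak differential `DF` which is locally `L³`
(integrable on every ball) and satisfies the integration-by-parts identity against every
smooth compactly supported test function, and `|DF|³ ≤ K · det DF` almost everywhere. -/
def IsQuasiconformal (K : ℝ) (F : Euc 3 → Euc 3) : Prop :=
  ∃ DF : Euc 3 → Euc 3 →L[ℝ] Euc 3,
    (∀ R : ℝ, 0 < R → IntegrableOn (fun x => ‖DF x‖ ^ (3 : ℕ)) (ball (0 : Euc 3) R) volume) ∧
    (∀ φ : Euc 3 → ℝ, ContDiff ℝ (⊤ : ℕ∞) φ → HasCompactSupport φ → ∀ v w : Euc 3,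
      ∫ x, fderiv ℝ φ x v * ⟪F x, w⟫ = - ∫ x, φ x * ⟪DF x v, w⟫) ∧
    ∀ᵐ x ∂(volume : Measure (Euc 3)), ‖DF x‖ ^ (3 : ℕ) ≤ K * (DF x).det

lemma setOf_mesh_cube_eq_image {d : ℕ} {r : ℝ} (hr : 0 < r) (E : Set (Euc d)) :
    {k : Fin d → ℤ | ∃ x ∈ E, ∀ i, (k i : ℝ) * r ≤ x i ∧ x i < ((k i : ℝ) + 1) * r} =
      (fun x : Euc d => fun i => ⌊x i / r⌋) '' E := by
  ext k
  simp only [mem_ofPred_eq, mem_image]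
  refine exists_congr fun x => and_congr_right fun _ => ?_
  rw [funext_iff]
  refine forall_congr' fun i => ?_
  rw [Int.floor_eq_iff, le_div_iff₀ hr, div_lt_iff₀ hr]

lemma meshCubeCount_eq_ncard_image {d : ℕ} {r : ℝ} (hr : 0 < r) (E : Set (Euc d)) :
    meshCubeCount d r E = ((fun x : Euc d => fun i => ⌊x i / r⌋) '' E).ncard := by
  rw [meshCubeCount, setOf_mesh_cube_eq_image hr]

lemma Euc.abs_coord_sub_le_dist {d : ℕ} (x y : Euc d) (i : Fin d) : |x i - y i| ≤ dist x y := by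
  rw [dist_eq_norm]
  simpa using PiLp.norm_apply_le (x - y) i

lemma card_Icc_floor_le {a b : ℝ} (hab : a ≤ b) :
    ((Finset.Icc ⌊a⌋ ⌊b⌋).card : ℝ) ≤ b - a + 2 := by
  rw [Int.card_Icc]
  have h1 : ⌊a⌋ ≤ ⌊b⌋ := Int.floor_le_floor hab
  have h2 : ((⌊b⌋ + 1 - ⌊a⌋).toNat : ℤ) = ⌊b⌋ + 1 - ⌊a⌋ := Int.toNat_of_nonneg (by omega)
  have h3 : ((⌊b⌋ + 1 - ⌊a⌋).toNat : ℝ) = ⌊b⌋ + 1 - ⌊a⌋ := by exact_mod_cast h2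
  rw [h3]
  linarith [Int.floor_le b, Int.lt_floor_add_one a]

/-- The indices of the `r`-mesh cubes that can meet the closed ball of radius `D` around `a`. -/
def meshBox (d : ℕ) (r : ℝ) (a : Euc d) (D : ℝ) : Finset (Fin d → ℤ) :=
  Fintype.piFinset fun i => Finset.Icc ⌊(a i - D) / r⌋ ⌊(a i + D) / r⌋

lemma floor_mem_meshBox {d : ℕ} {r : ℝ} (hr : 0 < r) {a x : Euc d} {D : ℝ} (h : dist x a ≤ D) :
    (fun i => ⌊x i / r⌋) ∈ meshBox d r a D := by
  rw [meshBox, Fintype.mem_piFinset]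
  intro i
  have := abs_le.1 ((Euc.abs_coord_sub_le_dist x a i).trans h)
  rw [Finset.mem_Icc]
  constructor <;> apply Int.floor_le_floor <;> gcongr <;> linarith

lemma card_meshBox_le {d : ℕ} {r : ℝ} (hr : 0 < r) (a : Euc d) {D : ℝ} (hD : 0 ≤ D) :
    ((meshBox d r a D).card : ℝ) ≤ (2 * D / r + 2) ^ d := by
  rw [meshBox, Fintype.card_piFinset]
  push_cast
  calc _ ≤ ∏ _i : Fin d, (2 * D / r + 2) := by
        refine Finset.prod_le_prod (fun _ _ => by positivity) fun i _ => ?_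
        refine (card_Icc_floor_le (by gcongr; linarith)).trans (le_of_eq ?_)
        field_simp
        ring
    _ = _ := by simp

lemma finite_image_floor {d : ℕ} {r : ℝ} (hr : 0 < r) {E : Set (Euc d)}
    (hE : Bornology.IsBounded E) :
    ((fun x : Euc d => fun i => ⌊x i / r⌋) '' E).Finite := by
  obtain ⟨D, hD⟩ := hE.subset_closedBall 0
  refine (meshBox d r 0 D).finite_toSet.subset ?_
  rintro _ ⟨x, hx, rfl⟩
  exact floor_mem_meshBox hr (hD hx)

lemma meshCubeCount_mono {d : ℕ} {r : ℝ} (hr : 0 < r) {E F : Set (Euc d)} (h : E ⊆ F)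
    (hF : Bornology.IsBounded F) : meshCubeCount d r E ≤ meshCubeCount d r F := by
  rw [meshCubeCount_eq_ncard_image hr, meshCubeCount_eq_ncard_image hr]
  exact ncard_le_ncard (image_mono h) (finite_image_floor hr hF)

lemma meshCubeCount_le_of_subset_closedBall {d : ℕ} {r : ℝ} (hr : 0 < r) {E : Set (Euc d)}
    {a : Euc d} {D : ℝ} (hD : 0 ≤ D) (h : E ⊆ closedBall a D) :
    (meshCubeCount d r E : ℝ) ≤ (2 * D / r + 2) ^ d := by
  refine le_trans ?_ (card_meshBox_le hr a hD)
  rw [meshCubeCount_eq_ncard_image hr, Nat.cast_le, ← ncard_coe_finset]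
  refine ncard_le_ncard ?_ (Finset.finite_toSet _)
  rintro _ ⟨x, hx, rfl⟩
  exact floor_mem_meshBox hr (h hx)

lemma meshCubeCount_le_of_dist_le {d : ℕ} {r : ℝ} (hr : 0 < r) {E : Set (Euc d)}
    {D : ℝ} (hD : 0 ≤ D) (h : ∀ x ∈ E, ∀ y ∈ E, dist x y ≤ D) :
    (meshCubeCount d r E : ℝ) ≤ (2 * D / r + 2) ^ d := by
  rcases E.eq_empty_or_nonempty with rfl | ⟨a, ha⟩
  · simp only [meshCubeCount_eq_ncard_image hr, image_empty, ncard_empty, Nat.cast_zero]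
    positivity
  · exact meshCubeCount_le_of_subset_closedBall hr hD fun x hx => h x hx a ha

lemma meshCubeCount_union_le {d : ℕ} {r : ℝ} (hr : 0 < r) (E F : Set (Euc d)) :
    meshCubeCount d r (E ∪ F) ≤ meshCubeCount d r E + meshCubeCount d r F := by
  simp only [meshCubeCount_eq_ncard_image hr, image_union]
  exact ncard_union_le _ _

lemma meshCubeCount_biUnion_le {d : ℕ} {ι : Type*} {r : ℝ} (hr : 0 < r) (s : Finset ι)
    (E : ι → Set (Euc d)) :
    meshCubeCount d r (⋃ i ∈ s, E i) ≤ ∑ i ∈ s, meshCubeCount d r (E i) := by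
  simp only [meshCubeCount_eq_ncard_image hr, image_iUnion]
  exact Finset.set_ncard_biUnion_le _ _

/-- A bounded set whose image under `φ` lies in a finite set, with each fibre meeting at most `N`
mesh cubes. -/
lemma meshCubeCount_le_card_mul {d : ℕ} {ι : Type*} {r N : ℝ} (hr : 0 < r) {E : Set (Euc d)}
    (hE : Bornology.IsBounded E) (s : Finset ι) (φ : Euc d → ι) (hφ : ∀ x ∈ E, φ x ∈ s)
    (hN : ∀ i ∈ s, (meshCubeCount d r {x ∈ E | φ x = i} : ℝ) ≤ N) :
    (meshCubeCount d r E : ℝ) ≤ s.card * N := by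
  have h1 : E ⊆ ⋃ i ∈ s, {x ∈ E | φ x = i} := fun x hx =>
    mem_iUnion₂.2 ⟨φ x, hφ x hx, hx, rfl⟩
  have h2 : Bornology.IsBounded (⋃ i ∈ s, {x ∈ E | φ x = i}) :=
    hE.subset (iUnion₂_subset fun i _ => sep_subset _ _)
  calc (meshCubeCount d r E : ℝ) ≤ meshCubeCount d r (⋃ i ∈ s, {x ∈ E | φ x = i}) := by
        exact_mod_cast meshCubeCount_mono hr h1 h2
    _ ≤ ∑ i ∈ s, (meshCubeCount d r {x ∈ E | φ x = i} : ℝ) := by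
        exact_mod_cast meshCubeCount_biUnion_le hr s _
    _ ≤ s.card * N := by
        simpa using Finset.sum_le_card_nsmul s _ N hN

lemma dist_lt_of_floor_eq {R : ℝ} (hR : 0 < R) {x y : Euc 3}
    (h : (fun i => ⌊x i / (R / 2)⌋) = fun i => ⌊y i / (R / 2)⌋) : dist x y < R := by
  have h1 : ∀ i, |x i - y i| < R / 2 := fun i => by
    have := Int.abs_sub_lt_one_of_floor_eq_floor (congrFun h i)
    rwa [← sub_div, abs_div, abs_of_pos (half_pos hR), div_lt_one (half_pos hR)] at this
  rw [EuclideanSpace.dist_eq, Real.sqrt_lt' hR, Fin.sum_univ_three]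
  simp only [Real.dist_eq]
  have h2 : ∀ i, |x i - y i| ^ 2 < (R / 2) ^ 2 := fun i =>
    pow_lt_pow_left₀ (h1 i) (abs_nonneg _) two_ne_zero
  nlinarith [h2 0, h2 1, h2 2, hR]

/-- If each ball of radius `R` centred in `E` meets `E` in at most `M` mesh cubes, then a
ball of radius `τ` meets `E` in at most `(4 τ / R + 2) ^ 3 * M` mesh cubes. -/
lemma meshCubeCount_closedBall_inter_le {r R τ M : ℝ} (hr : 0 < r) (hR : 0 < R) (hτ : 0 ≤ τ)
    (hM : 0 ≤ M) {E : Set (Euc 3)} (hE : ∀ x ∈ E, (meshCubeCount 3 r (ball x R ∩ E) : ℝ) ≤ M) :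
    (meshCubeCount 3 r (closedBall 0 τ ∩ E) : ℝ) ≤ (4 * τ / R + 2) ^ 3 * M := by
  have hR2 := half_pos hR
  refine (meshCubeCount_le_card_mul hr (isBounded_closedBall.subset inter_subset_left)
    (meshBox 3 (R / 2) 0 τ) (fun x i => ⌊x i / (R / 2)⌋)
    (fun x hx => floor_mem_meshBox hR2 hx.1) (N := M) ?_).trans ?_
  · intro k _
    rcases {x ∈ closedBall 0 τ ∩ E | (fun i => ⌊x i / (R / 2)⌋) = k}.eq_empty_or_nonempty
      with h | ⟨a, ha⟩
    · rw [h]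
      simpa [meshCubeCount] using hM
    · refine le_trans ?_ (hE a ha.1.2)
      norm_cast
      refine meshCubeCount_mono hr (fun x hx => ⟨?_, hx.1.2⟩)
        (isBounded_ball.subset inter_subset_left)
      exact dist_lt_of_floor_eq hR (hx.2.trans ha.2.symm)
  · gcongr
    refine (card_meshBox_le hR2 0 hτ).trans (le_of_eq ?_)
    congr 2
    field_simp
    ring

/-- The point of `ℝ³` with radius `ρ`, azimuth `u` and polar angle `v`. -/
def spherical (ρ u v : ℝ) : Euc 3 :=
  !₂[ρ * Real.cos u * Real.sin v, ρ * Real.sin u * Real.sin v, ρ * Real.cos v]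

lemma dist_spherical_sq (ρ u v ρ' u' v' : ℝ) :
    dist (spherical ρ u v) (spherical ρ' u' v') ^ 2 =
      (ρ - ρ') ^ 2 + 2 * (ρ * ρ') * (1 - Real.cos (v - v')) +
        2 * (ρ * Real.sin v * (ρ' * Real.sin v')) * (1 - Real.cos (u - u')) := by
  rw [EuclideanSpace.dist_eq, Real.sq_sqrt (by positivity), Fin.sum_univ_three]
  simp only [spherical, Real.dist_eq, sq_abs, Real.cos_sub]
  simp only [Matrix.cons_val_zero, Matrix.cons_val_one, Matrix.cons_val]
  linear_combination ρ ^ 2 * Real.sin v ^ 2 * Real.sin_sq_add_cos_sq u +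
    ρ' ^ 2 * Real.sin v' ^ 2 * Real.sin_sq_add_cos_sq u' +
    ρ ^ 2 * Real.sin_sq_add_cos_sq v + ρ' ^ 2 * Real.sin_sq_add_cos_sq v'

lemma norm_spherical {ρ : ℝ} (hρ : 0 ≤ ρ) (u v : ℝ) : ‖spherical ρ u v‖ = ρ := by
  rw [EuclideanSpace.norm_eq, Real.sqrt_eq_iff_eq_sq (by positivity) hρ, Fin.sum_univ_three]
  simp only [spherical, Real.norm_eq_abs, sq_abs]
  simp only [Matrix.cons_val_zero, Matrix.cons_val_one, Matrix.cons_val]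
  linear_combination ρ ^ 2 * Real.sin v ^ 2 * Real.sin_sq_add_cos_sq u +
    ρ ^ 2 * Real.sin_sq_add_cos_sq v

lemma sq_le_of_abs_le_pi {x : ℝ} (hx : |x| ≤ Real.pi) : x ^ 2 ≤ 10 * (1 - Real.cos x) / 2 := by
  have h := Real.cos_le_one_sub_mul_cos_sq hx
  have hpi : Real.pi ^ 2 ≤ 10 := by nlinarith [Real.pi_lt_d2, Real.pi_pos]
  have h2 : 2 / 10 * x ^ 2 ≤ 2 / Real.pi ^ 2 * x ^ 2 := by gcongr
  linarith

/-- Nearby points of a spherical-coordinate patch have nearby coordinates. -/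
lemma coord_sub_le_of_dist_spherical_le {ρ u v ρ' u' v' c M g D : ℝ} (hc : 0 < c) (hM : 0 < M)
    (hD : 0 ≤ D) (hρ : c * M ≤ ρ) (hρ' : c * M ≤ ρ')
    (hg : c * (g * |u - u'|) ≤ |ρ - ρ'|) (hu : |u - u'| ≤ 1) (hv : |v - v'| ≤ Real.pi)
    (hs : 0 ≤ Real.sin v * Real.sin v')
    (hdist : dist (spherical ρ u v) (spherical ρ' u' v') ≤ D) :
    c * (M * |v - v'|) ≤ 3 * D ∧ c * (g * |u - u'|) ≤ D ∧
      |ρ * Real.sin v| * |u - u'| ≤ 3 * D := by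
  have hcM : 0 < c * M := by positivity
  have hd2 := pow_le_pow_left₀ dist_nonneg hdist 2
  rw [dist_spherical_sq] at hd2
  have hρρ : (c * M) ^ 2 ≤ ρ * ρ' := by nlinarith
  have hρρ0 : 0 ≤ ρ * ρ' := le_trans (by positivity) hρρ
  have hss : 0 ≤ ρ * Real.sin v * (ρ' * Real.sin v') := by
    nlinarith [mul_nonneg hρρ0 hs]
  have hcv : 0 ≤ 1 - Real.cos (v - v') := by linarith [Real.cos_le_one (v - v')]
  have hcu : 0 ≤ 1 - Real.cos (u - u') := by linarith [Real.cos_le_one (u - u')]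
  have hvq := sq_le_of_abs_le_pi hv
  have huq := sq_le_of_abs_le_pi (hu.trans (by linarith [Real.pi_gt_three]))
  have hA : 0 ≤ 2 * (ρ * ρ') * (1 - Real.cos (v - v')) := by positivity
  have hB := mul_nonneg (mul_nonneg zero_le_two hss) hcu
  refine ⟨?_, ?_, ?_⟩
  · refine abs_le_of_sq_le_sq' ?_ (by positivity) |>.2
    calc (c * (M * |v - v'|)) ^ 2 = (c * M) ^ 2 * (v - v') ^ 2 := by
          rw [← sq_abs (v - v')]; ring
      _ ≤ (ρ * ρ') * (10 * (1 - Real.cos (v - v')) / 2) := by gcongr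
      _ ≤ (3 * D) ^ 2 := by nlinarith [sq_nonneg (ρ - ρ')]
  · refine hg.trans (abs_le_of_sq_le_sq ?_ hD)
    nlinarith
  · have hsdiff : |ρ * Real.sin v - ρ' * Real.sin v'| ≤ D := by
      refine abs_le_of_sq_le_sq ?_ hD
      have : (ρ * Real.sin v - ρ' * Real.sin v') ^ 2 + (ρ * Real.cos v - ρ' * Real.cos v') ^ 2 =
          (ρ - ρ') ^ 2 + 2 * (ρ * ρ') * (1 - Real.cos (v - v')) := by
        rw [Real.cos_sub]
        linear_combination ρ ^ 2 * Real.sin_sq_add_cos_sq v + ρ' ^ 2 * Real.sin_sq_add_cos_sq v'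
      nlinarith [sq_nonneg (ρ * Real.cos v - ρ' * Real.cos v')]
    set s := ρ * Real.sin v
    set s' := ρ' * Real.sin v'
    set X := |u - u'| with hX
    have hX0 : 0 ≤ X := abs_nonneg _
    have h1 : s * s' * X ^ 2 ≤ 5 / 2 * D ^ 2 := by
      rw [hX, sq_abs]
      nlinarith [mul_le_mul_of_nonneg_left huq hss, sq_nonneg (ρ - ρ')]
    have h2 : s * (s - s') ≤ |s| * D := by
      refine (le_abs_self _).trans ?_
      rw [abs_mul]
      gcongr
    have h3 : (|s| * X) ^ 2 ≤ 5 / 2 * D ^ 2 + (|s| * X) * D := by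
      have h4 : (|s| * X) ^ 2 = s * s' * X ^ 2 + s * (s - s') * X ^ 2 := by
        rw [mul_pow, sq_abs]; ring
      have h5 : s * (s - s') * X ^ 2 ≤ |s| * D * X ^ 2 := by gcongr
      have h6 : |s| * D * X ^ 2 ≤ |s| * D * X := by
        have : X ^ 2 ≤ X := by nlinarith
        gcongr
      linarith
    by_contra! h
    nlinarith

/-- Points of a spherical-coordinate patch with nearby coordinates are close. -/
lemma dist_spherical_le {ρ u v ρ' u' v' M W r : ℝ} (hr : 0 ≤ r) (hM : 0 < M) (hW : 0 < W)
    (hρ0' : 0 ≤ ρ') (hρ : ρ ≤ M) (hρ' : ρ' ≤ M) (hρρ' : |ρ - ρ'| ≤ 2 * (W * |u - u'|))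
    (hs : |ρ * Real.sin v| ≤ 2 * W) (hs' : |ρ' * Real.sin v'| ≤ 2 * W)
    (hu : W * |u - u'| ≤ r) (hv : M * |v - v'| ≤ r) :
    dist (spherical ρ u v) (spherical ρ' u' v') ≤ 3 * r := by
  refine abs_le_of_sq_le_sq' ?_ (by positivity) |>.2
  rw [dist_spherical_sq]
  have h1 := Real.one_sub_sq_div_two_le_cos (x := v - v')
  have h2 := Real.one_sub_sq_div_two_le_cos (x := u - u')
  have e1 : (ρ - ρ') ^ 2 ≤ (2 * r) ^ 2 := by
    rw [← sq_abs]
    gcongr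
    linarith
  have e2 : 2 * (ρ * ρ') * (1 - Real.cos (v - v')) ≤ r ^ 2 := by
    calc 2 * (ρ * ρ') * (1 - Real.cos (v - v')) ≤ 2 * (M * M) * ((v - v') ^ 2 / 2) := by
          gcongr
          · linarith [Real.cos_le_one (v - v')]
          · linarith
      _ = (M * |v - v'|) ^ 2 := by rw [mul_pow, sq_abs]; ring
      _ ≤ r ^ 2 := by gcongr
  have e3 : 2 * (ρ * Real.sin v * (ρ' * Real.sin v')) * (1 - Real.cos (u - u')) ≤ 4 * r ^ 2 := by
    calc 2 * (ρ * Real.sin v * (ρ' * Real.sin v')) * (1 - Real.cos (u - u')) ≤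
          2 * ((2 * W) * (2 * W)) * ((u - u') ^ 2 / 2) := by
          have : ρ * Real.sin v * (ρ' * Real.sin v') ≤ (2 * W) * (2 * W) := by
            refine (le_abs_self _).trans ?_
            rw [abs_mul]
            gcongr
          gcongr
          · linarith [Real.cos_le_one (u - u')]
          · linarith
      _ = 4 * (W * |u - u'|) ^ 2 := by rw [mul_pow, sq_abs]; ring
      _ ≤ 4 * r ^ 2 := by gcongr
  nlinarith

/-- A positive bounded function on a nonempty set is almost maximised, up to a factor `2`. -/
lemma exists_forall_le_two_mul {α : Type*} {s : Set α} (hs : s.Nonempty) {W : α → ℝ} {B : ℝ}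
    (hpos : ∀ x ∈ s, 0 < W x) (hB : ∀ x ∈ s, W x ≤ B) : ∃ x ∈ s, ∀ y ∈ s, W y ≤ 2 * W x := by
  have hbdd : BddAbove (W '' s) := ⟨B, by rintro _ ⟨x, hx, rfl⟩; exact hB x hx⟩
  obtain ⟨x₀, hx₀⟩ := hs
  have h0 : 0 < sSup (W '' s) := (hpos x₀ hx₀).trans_le (le_csSup hbdd (mem_image_of_mem W hx₀))
  obtain ⟨_, ⟨x, hx, rfl⟩, h⟩ := exists_lt_of_lt_csSup ⟨_, mem_image_of_mem W hx₀⟩ (half_lt_self h0)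
  exact ⟨x, hx, fun y hy => by linarith [le_csSup hbdd (mem_image_of_mem W hy)]⟩

/-- A set of diameter `D` inside a patch `{spherical (ρ u) u v}` of a sphere or of a spiral shell
meets at most a constant multiple of `(D / r) ^ 2` mesh cubes. -/
lemma meshCubeCount_patch_le {ρ : ℝ → ℝ} {a b c M g r D : ℝ} (hc : 0 < c) (hc1 : c ≤ 1)
    (hM : 0 < M) (hg : 0 ≤ g) (hr : 0 < r) (hrD : r ≤ D)
    (hρ : ∀ u ∈ Icc a (a + 1), c * M ≤ ρ u ∧ ρ u ≤ M)
    (hρg : ∀ u ∈ Icc a (a + 1), ∀ u' ∈ Icc a (a + 1),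
      c * (g * |u - u'|) ≤ |ρ u - ρ u'| ∧ |ρ u - ρ u'| ≤ g * |u - u'|)
    (hb : ∀ v ∈ Icc b (b + Real.pi), ∀ v' ∈ Icc b (b + Real.pi), 0 ≤ Real.sin v * Real.sin v')
    {Q : Set (Euc 3)} (hQ : ∀ x ∈ Q, ∃ u ∈ Icc a (a + 1), ∃ v ∈ Icc b (b + Real.pi),
      x = spherical (ρ u) u v) (hQD : ∀ x ∈ Q, ∀ y ∈ Q, dist x y ≤ D) :
    (meshCubeCount 3 r Q : ℝ) ≤ 512 * (12 / c) ^ 2 * (D / r) ^ 2 := by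
  have hD : 0 < D := hr.trans_le hrD
  rcases Q.eq_empty_or_nonempty with rfl | hne
  · simp only [meshCubeCount_eq_ncard_image hr, image_empty, ncard_empty, Nat.cast_zero]
    positivity
  choose! U hU V hV hx using hQ
  set s : Euc 3 → ℝ := fun x => |ρ (U x) * Real.sin (V x)| with hs
  have hρpos : ∀ x ∈ Q, 0 < ρ (U x) := fun x h =>
    (mul_pos hc hM).trans_le (hρ _ (hU x h)).1
  have hsM : ∀ x ∈ Q, s x ≤ M := fun x h => by
    rw [hs]
    simp only [abs_mul, abs_of_pos (hρpos x h)]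
    exact (mul_le_of_le_one_right (hρpos x h).le (Real.abs_sin_le_one _)).trans (hρ _ (hU x h)).2
  have hs0 : ∀ x, 0 ≤ s x := fun x => abs_nonneg _
  obtain ⟨x₁, hx₁, hmax⟩ := exists_forall_le_two_mul (W := fun x => g + s x + r) (B := g + M + r)
    hne (fun x _ => by have := hs0 x; positivity) (fun x h => by linarith [hsM x h])
  set W := g + s x₁ + r with hW
  have hWpos : 0 < W := by have := hs0 x₁; positivity
  have hUle : ∀ x ∈ Q, ∀ y ∈ Q, |U x - U y| ≤ 1 := fun x h y h' => by
    rw [abs_le]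
    constructor <;> linarith [(hU x h).1, (hU x h).2, (hU y h').1, (hU y h').2]
  have hVle : ∀ x ∈ Q, ∀ y ∈ Q, |V x - V y| ≤ Real.pi := fun x h y h' => by
    rw [abs_le]
    constructor <;> linarith [(hV x h).1, (hV x h).2, (hV y h').1, (hV y h').2]
  have hclose : ∀ x ∈ Q, |W * (U x - U x₁)| ≤ 5 * D / c ∧ |M * (V x - V x₁)| ≤ 5 * D / c := by
    intro x h
    obtain ⟨h1, h2, h3⟩ := coord_sub_le_of_dist_spherical_le hc hM hD.le (hρ _ (hU _ hx₁)).1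
      (hρ _ (hU x h)).1 (hρg _ (hU _ hx₁) _ (hU x h)).1 (hUle _ hx₁ x h) (hVle _ hx₁ x h)
      (hb _ (hV _ hx₁) _ (hV x h))
      (by rw [← hx _ hx₁, ← hx x h]; exact hQD _ hx₁ x h)
    rw [abs_mul, abs_mul, abs_of_pos hWpos, abs_of_pos hM, abs_sub_comm (U x), abs_sub_comm (V x),
      le_div_iff₀ hc, le_div_iff₀ hc]
    refine ⟨?_, by linarith⟩
    have h4 : r * |U x₁ - U x| ≤ D := by nlinarith [hUle _ hx₁ x h]
    have h5 : s x₁ * |U x₁ - U x| + r * |U x₁ - U x| ≤ 4 * D := by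
      rw [hs]
      linarith
    calc W * |U x₁ - U x| * c
        = c * (g * |U x₁ - U x|) + c * (s x₁ * |U x₁ - U x| + r * |U x₁ - U x|) := by
          rw [hW]; ring
      _ ≤ D + 1 * (4 * D) := by
          gcongr
      _ = 5 * D := by ring
  set I := Finset.Icc ⌊-(5 * D / c) / r⌋ ⌊(5 * D / c) / r⌋ with hI
  have hIcard : (I.card : ℝ) ≤ 12 / c * (D / r) := by
    have h5 : 0 < 5 * D / c := by positivity
    refine (card_Icc_floor_le (by gcongr; linarith)).trans ?_
    have h1 : 1 ≤ D / r := (one_le_div hr).2 hrD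
    have h2 : 1 ≤ 1 / c := (one_le_div hc).2 hc1
    have h3 : 1 ≤ 1 / c * (D / r) := by nlinarith
    calc 5 * D / c / r - -(5 * D / c) / r + 2 = 10 * (1 / c * (D / r)) + 2 := by
          field_simp; ring
      _ ≤ 12 * (1 / c * (D / r)) := by linarith
      _ = _ := by ring
  refine (meshCubeCount_le_card_mul (N := 512) hr
    (isBounded_iff.2 ⟨D, fun x h y h' => hQD x h y h'⟩) (I ×ˢ I)
    (fun x => (⌊W * (U x - U x₁) / r⌋, ⌊M * (V x - V x₁) / r⌋)) (fun x h => ?_) ?_).trans ?_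
  · obtain ⟨h1, h2⟩ := hclose x h
    rw [abs_le] at h1 h2
    simp only [hI, Finset.mem_product, Finset.mem_Icc]
    refine ⟨⟨?_, ?_⟩, ?_, ?_⟩ <;> apply Int.floor_le_floor <;> gcongr
    exacts [h1.1, h1.2, h2.1, h2.2]
  · intro i _
    refine (meshCubeCount_le_of_dist_le (D := 3 * r) hr (by positivity) ?_).trans (le_of_eq ?_)
    · rintro x ⟨h, rfl⟩ y ⟨h', hxy⟩
      rw [Prod.mk.injEq] at hxy
      have e1 := Int.abs_sub_lt_one_of_floor_eq_floor hxy.1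
      have e2 := Int.abs_sub_lt_one_of_floor_eq_floor hxy.2
      rw [← sub_div, abs_div, abs_of_pos hr, div_lt_one hr, ← mul_sub, abs_mul] at e1 e2
      rw [abs_of_pos hWpos, sub_sub_sub_cancel_right, abs_sub_comm] at e1
      rw [abs_of_pos hM, sub_sub_sub_cancel_right, abs_sub_comm] at e2
      rw [hx x h, hx y h']
      have hgW : g ≤ W := by linarith [hs0 x₁]
      refine dist_spherical_le (W := W) hr.le hM hWpos (hρpos y h').le (hρ _ (hU x h)).2
        (hρ _ (hU y h')).2 ?_ ?_ ?_ e1.le e2.le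
      · refine (hρg _ (hU x h) _ (hU y h')).2.trans ?_
        have : g * |U x - U y| ≤ W * |U x - U y| := by gcongr
        nlinarith [mul_nonneg hWpos.le (abs_nonneg (U x - U y))]
      · linarith [hmax x h]
      · linarith [hmax y h']
    · rw [show 2 * (3 * r) / r = 6 by rw [div_eq_iff hr.ne']; ring]
      norm_num
  · rw [Finset.card_product]
    push_cast
    calc (I.card : ℝ) * I.card * 512 ≤ (12 / c * (D / r)) * (12 / c * (D / r)) * 512 :=
          mul_le_mul_of_nonneg_right (mul_self_le_mul_self (Nat.cast_nonneg _) hIcard) (by norm_num)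
      _ = _ := by ring

/-- `E` is covered by layers `T j`, `j ≥ 1`, where `T j` lies in the ball of radius `j ^ (-p)`
around the origin and is at most two-dimensional, uniformly in `j` and in all scales. -/
def HasThinLayers (p : ℝ) (E : Set (Euc 3)) : Prop :=
  ∃ A : ℝ, 0 < A ∧ ∃ T : ℕ → Set (Euc 3),
    (∀ x ∈ E, ∃ j : ℕ, 1 ≤ j ∧ x ∈ T j) ∧
    (∀ j : ℕ, 1 ≤ j → T j ⊆ closedBall 0 ((j : ℝ) ^ (-p))) ∧
    ∀ j : ℕ, 1 ≤ j → ∀ r D : ℝ, 0 < r → r ≤ D → ∀ Q ⊆ T j,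
      (∀ x ∈ Q, ∀ y ∈ Q, dist x y ≤ D) → (meshCubeCount 3 r Q : ℝ) ≤ A * (D / r) ^ 2

lemma rpow_neg_sub_rpow_neg_bounds {p a b : ℝ} (hp : 0 < p) (ha : 0 < a) (hab : a ≤ b) :
    p * b ^ (-p - 1) * (b - a) ≤ a ^ (-p) - b ^ (-p) ∧
      a ^ (-p) - b ^ (-p) ≤ p * a ^ (-p - 1) * (b - a) := by
  rcases hab.eq_or_lt with rfl | hlt
  · simp
  have hd : ∀ x ∈ Icc a b, HasDerivAt (fun x : ℝ => x ^ (-p)) (-p * x ^ (-p - 1)) x := fun x hx =>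
    Real.hasDerivAt_rpow_const (Or.inl (ha.trans_le hx.1).ne')
  obtain ⟨c, hc, h⟩ := exists_hasDerivAt_eq_slope (fun x : ℝ => x ^ (-p)) _ hlt
    (fun x hx => (hd x hx).continuousAt.continuousWithinAt) (fun x hx => hd x (Ioo_subset_Icc_self hx))
  rw [eq_div_iff (sub_pos.2 hlt).ne'] at h
  have h1 : a ^ (-p) - b ^ (-p) = p * c ^ (-p - 1) * (b - a) := by linarith
  have hba := (sub_pos.2 hlt).le
  rw [h1]
  constructor
  · have := Real.rpow_le_rpow_of_nonpos (ha.trans hc.1) hc.2.le (z := -p - 1) (by linarith)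
    gcongr
  · have := Real.rpow_le_rpow_of_nonpos ha hc.1.le (z := -p - 1) (by linarith)
    gcongr

lemma sin_mul_sin_nonneg_of_mem_Icc_zero : ∀ v ∈ Icc 0 (0 + Real.pi),
    ∀ v' ∈ Icc 0 (0 + Real.pi), 0 ≤ Real.sin v * Real.sin v' := by
  intro v hv v' hv'
  rw [zero_add] at hv hv'
  exact mul_nonneg (Real.sin_nonneg_of_mem_Icc hv) (Real.sin_nonneg_of_mem_Icc hv')

lemma sin_mul_sin_nonneg_of_mem_Icc_pi : ∀ v ∈ Icc Real.pi (Real.pi + Real.pi),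
    ∀ v' ∈ Icc Real.pi (Real.pi + Real.pi), 0 ≤ Real.sin v * Real.sin v' := by
  intro v hv v' hv'
  have h := sin_mul_sin_nonneg_of_mem_Icc_zero (v - Real.pi)
    ⟨by linarith [hv.1], by linarith [hv.2]⟩ (v' - Real.pi) ⟨by linarith [hv'.1], by linarith [hv'.2]⟩
  simpa [Real.sin_sub_pi] using h

lemma spherical_norm_arg_arccos {x : Euc 3} (hx : 0 < ‖x‖) :
    x = spherical ‖x‖ (Complex.arg ⟨x 0, x 1⟩) (Real.arccos (x 2 / ‖x‖)) := by
  have hn : ‖x‖ ^ 2 = x 0 ^ 2 + x 1 ^ 2 + x 2 ^ 2 := by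
    rw [EuclideanSpace.norm_sq_eq, Fin.sum_univ_three]
    simp
  have hz : |x 2 / ‖x‖| ≤ 1 := by
    rw [abs_div, abs_of_pos hx, div_le_one hx]
    exact PiLp.norm_apply_le x 2
  have hw : ‖(⟨x 0, x 1⟩ : ℂ)‖ = ‖x‖ * Real.sin (Real.arccos (x 2 / ‖x‖)) := by
    rw [Real.sin_arccos, Complex.norm_eq_sqrt_sq_add_sq,
      Real.sqrt_eq_iff_eq_sq (by positivity) (by positivity), mul_pow,
      Real.sq_sqrt (sub_nonneg.2 ((sq_le_one_iff_abs_le_one _).2 hz))]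
    field_simp
    linarith
  have hcos := Complex.norm_mul_cos_arg ⟨x 0, x 1⟩
  have hsin := Complex.norm_mul_sin_arg ⟨x 0, x 1⟩
  rw [hw] at hcos hsin
  simp only at hcos hsin
  rw [abs_le] at hz
  ext i
  fin_cases i
  · simp only [spherical]
    simp
    linarith
  · simp only [spherical]
    simp
    linarith
  · simp only [spherical]
    simp
    rw [Real.cos_arccos hz.1 hz.2]
    field_simp

lemma spherical_toIcoMod (ρ u v : ℝ) :
    spherical ρ u v = spherical ρ u (toIcoMod Real.two_pi_pos 0 v) := by
  have h : toIcoMod Real.two_pi_pos 0 v = v - toIcoDiv Real.two_pi_pos 0 v * (2 * Real.pi) := by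
    rw [toIcoMod, zsmul_eq_mul]
  rw [spherical, spherical, h, Real.sin_sub_int_mul_two_pi, Real.cos_sub_int_mul_two_pi]

lemma mem_spiralShell_iff {p : ℝ} {x : Euc 3} :
    x ∈ spiralShell p ↔ ∃ u v : ℝ, 1 ≤ u ∧ 1 ≤ v ∧ x = spherical (u ^ (-p)) u v := Iff.rfl

lemma mem_sphereUnion_iff {p : ℝ} {x : Euc 3} :
    x ∈ sphereUnion p ↔ ∃ j : ℕ, 1 ≤ j ∧ ‖x‖ = (j : ℝ) ^ (-p) := by
  simp only [sphereUnion, mem_iUnion, mem_sphere_zero_iff_norm]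
  constructor
  · rintro ⟨j, hj⟩
    exact ⟨j + 1, by omega, by simpa using hj⟩
  · rintro ⟨j, hj, h⟩
    exact ⟨j - 1, by rw [h, Nat.cast_sub hj]; simp⟩

lemma hasThinLayers_sphereUnion (p : ℝ) : HasThinLayers p (sphereUnion p) := by
  refine ⟨8 * (512 * (12 / 1) ^ 2), by positivity, fun j => sphere 0 ((j : ℝ) ^ (-p)),
    fun x hx => ?_, fun j _ => sphere_subset_closedBall, fun j hj r D hr hrD Q hQ hQD => ?_⟩
  · obtain ⟨j, hj, h⟩ := mem_sphereUnion_iff.1 hx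
    exact ⟨j, hj, mem_sphere_zero_iff_norm.2 h⟩
  have hM : 0 < (j : ℝ) ^ (-p) := Real.rpow_pos_of_pos (by exact_mod_cast hj) _
  refine (meshCubeCount_le_card_mul hr (isBounded_iff.2 ⟨D, fun x h y h' => hQD x h y h'⟩)
    (Finset.Icc (-4) 3) (fun x => ⌊Complex.arg ⟨x 0, x 1⟩⌋) (fun x _ => ?_)
    (N := 512 * (12 / 1) ^ 2 * (D / r) ^ 2) fun k _ => ?_).trans (le_of_eq ?_)
  · have h1 := Complex.neg_pi_lt_arg ⟨x 0, x 1⟩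
    have h2 := Complex.arg_le_pi ⟨x 0, x 1⟩
    have h3 := Real.pi_lt_four
    rw [Finset.mem_Icc, Int.le_floor, ← Int.lt_add_one_iff, Int.floor_lt]
    push_cast
    constructor <;> linarith
  · refine meshCubeCount_patch_le (ρ := fun _ => (j : ℝ) ^ (-p)) (a := k) (b := 0) (c := 1)
      (M := (j : ℝ) ^ (-p)) (g := 0) one_pos le_rfl hM le_rfl hr hrD (by simp) (by simp)
      sin_mul_sin_nonneg_of_mem_Icc_zero ?_ (fun x h y h' => hQD x h.1 y h'.1)
    rintro x ⟨h, hk⟩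
    have hx : ‖x‖ = (j : ℝ) ^ (-p) := mem_sphere_zero_iff_norm.1 (hQ h)
    refine ⟨_, ⟨Int.floor_le _ |>.trans' (by rw [hk]), ?_⟩, _, ⟨Real.arccos_nonneg _, ?_⟩,
      hx ▸ spherical_norm_arg_arccos (hx ▸ hM)⟩
    · rw [← hk]
      exact (Int.lt_floor_add_one _).le
    · rw [zero_add]
      exact Real.arccos_le_pi _
  · simp
    ring

lemma hasThinLayers_spiralShell {p : ℝ} (hp : 0 < p) : HasThinLayers p (spiralShell p) := by
  set c : ℝ := 2 ^ (-p - 1) with hc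
  have hc0 : 0 < c := by positivity
  have hc1 : c ≤ 1 := Real.rpow_le_one_of_one_le_of_nonpos one_le_two (by linarith)
  refine ⟨2 * (512 * (12 / c) ^ 2), by positivity,
    fun j => {x | ∃ u ∈ Icc (j : ℝ) (j + 1), ∃ v, x = spherical (u ^ (-p)) u v},
    fun x hx => ?_, fun j hj => ?_, fun j hj r D hr hrD Q hQ hQD => ?_⟩
  · obtain ⟨u, v, hu, -, rfl⟩ := mem_spiralShell_iff.1 hx
    exact ⟨⌊u⌋₊, Nat.one_le_floor_iff _ |>.2 hu, u,
      ⟨Nat.floor_le (by linarith), (Nat.lt_floor_add_one u).le⟩, v, rfl⟩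
  · rintro _ ⟨u, hu, v, rfl⟩
    have hj' : (0 : ℝ) < j := by exact_mod_cast hj
    rw [mem_closedBall_zero_iff, norm_spherical (Real.rpow_nonneg (hj'.le.trans hu.1) _)]
    exact Real.rpow_le_rpow_of_nonpos hj' hu.1 (by linarith)
  have hj1 : (1 : ℝ) ≤ j := by exact_mod_cast hj
  have hj0 : (0 : ℝ) < j := by linarith
  have hdouble : ∀ u ∈ Icc (j : ℝ) (j + 1), ∀ z : ℝ, z ≤ 0 →
      2 ^ z * (j : ℝ) ^ z ≤ u ^ z := by
    intro u hu z hz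
    rw [← Real.mul_rpow zero_le_two hj0.le]
    exact Real.rpow_le_rpow_of_nonpos (hj0.trans_le hu.1) (by linarith [hu.2]) hz
  have hρ : ∀ u ∈ Icc (j : ℝ) (j + 1), c * (j : ℝ) ^ (-p) ≤ u ^ (-p) ∧ u ^ (-p) ≤ (j : ℝ) ^ (-p) := by
    intro u hu
    refine ⟨(hdouble u hu (-p) (by linarith)).trans' ?_,
      Real.rpow_le_rpow_of_nonpos hj0 hu.1 (by linarith)⟩
    have : c ≤ 2 ^ (-p) := Real.rpow_le_rpow_of_exponent_le one_le_two (by linarith)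
    gcongr
  set g : ℝ := p * (j : ℝ) ^ (-p - 1) with hg
  have hg0 : 0 ≤ g := by positivity
  have hmono : ∀ u ∈ Icc (j : ℝ) (j + 1), ∀ u' ∈ Icc (j : ℝ) (j + 1), u ≤ u' →
      c * (g * |u - u'|) ≤ |u ^ (-p) - u' ^ (-p)| ∧ |u ^ (-p) - u' ^ (-p)| ≤ g * |u - u'| := by
    intro u hu u' hu' huu'
    have hu0 := hj0.trans_le hu.1
    obtain ⟨h1, h2⟩ := rpow_neg_sub_rpow_neg_bounds hp hu0 huu'
    have h3 : 0 ≤ u' - u := by linarith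
    rw [abs_sub_comm u, abs_of_nonneg h3, abs_of_nonneg (h1.trans' (by
      have := hu0.trans_le huu'
      positivity))]
    constructor
    · refine h1.trans' ?_
      calc c * (g * (u' - u)) = p * (2 ^ (-p - 1) * (j : ℝ) ^ (-p - 1)) * (u' - u) := by
            rw [hc, hg]; ring
        _ ≤ _ := by
            gcongr
            exact hdouble u' hu' _ (by linarith)
    · refine h2.trans ?_
      have := Real.rpow_le_rpow_of_nonpos hj0 hu.1 (z := -p - 1) (by linarith)
      rw [hg]
      gcongr
  have hρg : ∀ u ∈ Icc (j : ℝ) (j + 1), ∀ u' ∈ Icc (j : ℝ) (j + 1),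
      c * (g * |u - u'|) ≤ |u ^ (-p) - u' ^ (-p)| ∧ |u ^ (-p) - u' ^ (-p)| ≤ g * |u - u'| := by
    intro u hu u' hu'
    rcases le_total u u' with h | h
    · exact hmono u hu u' hu' h
    · rw [abs_sub_comm u, abs_sub_comm (u ^ (-p))]
      exact hmono u' hu' u hu h
  have hM : 0 < (j : ℝ) ^ (-p) := by positivity
  set S : ℝ → Set (Euc 3) := fun b => {x | ∃ u ∈ Icc (j : ℝ) (j + 1),
    ∃ v ∈ Icc b (b + Real.pi), x = spherical (u ^ (-p)) u v} with hS
  have hcover : Q = Q ∩ S 0 ∪ Q ∩ S Real.pi := by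
    rw [← inter_union_distrib_left, eq_comm, inter_eq_left]
    intro x hx
    obtain ⟨u, hu, v, rfl⟩ := hQ hx
    have hmem := toIcoMod_mem_Ico Real.two_pi_pos 0 v
    rw [spherical_toIcoMod]
    rcases le_total (toIcoMod Real.two_pi_pos 0 v) Real.pi with h | h
    · exact Or.inl ⟨u, hu, _, ⟨hmem.1, by linarith⟩, rfl⟩
    · exact Or.inr ⟨u, hu, _, ⟨h, by linarith [hmem.2]⟩, rfl⟩
  have hpiece : ∀ b, (∀ v ∈ Icc b (b + Real.pi), ∀ v' ∈ Icc b (b + Real.pi),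
      0 ≤ Real.sin v * Real.sin v') →
      (meshCubeCount 3 r (Q ∩ S b) : ℝ) ≤ 512 * (12 / c) ^ 2 * (D / r) ^ 2 := fun b hb =>
    meshCubeCount_patch_le (ρ := fun u => u ^ (-p)) hc0 hc1 hM hg0 hr hrD hρ hρg hb
      (fun x hx => hx.2) (fun x hx y hy => hQD x hx.1 y hy.1)
  calc (meshCubeCount 3 r Q : ℝ) ≤
        meshCubeCount 3 r (Q ∩ S 0) + meshCubeCount 3 r (Q ∩ S Real.pi) := by
        conv_lhs => rw [hcover]
        exact_mod_cast meshCubeCount_union_le hr _ _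
    _ ≤ 512 * (12 / c) ^ 2 * (D / r) ^ 2 + 512 * (12 / c) ^ 2 * (D / r) ^ 2 :=
        add_le_add (hpiece 0 sin_mul_sin_nonneg_of_mem_Icc_zero)
          (hpiece Real.pi sin_mul_sin_nonneg_of_mem_Icc_pi)
    _ = _ := by ring

/-- The point with first coordinate `s` on the ray from the origin through `(1, y, z)`. -/
def rayPoint (s y z : ℝ) : Euc 3 := !₂[s, s * y, s * z]

/-- Every ray through a point `(1, y, z)` with `y, z ∈ [0, 1]` meets `E` in points of norms
`(β + ω k) ^ (-p)`, `k ≥ 1`, where the period `ω` does not depend on the ray. -/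
def HasPeriodicRays (p : ℝ) (E : Set (Euc 3)) : Prop :=
  ∃ ω : ℝ, 1 ≤ ω ∧ ∀ y ∈ Icc (0 : ℝ) 1, ∀ z ∈ Icc (0 : ℝ) 1, ∃ β ∈ Icc 0 ω, ∀ k : ℕ, 1 ≤ k →
    rayPoint ((β + ω * k) ^ (-p) / √(1 + y ^ 2 + z ^ 2)) y z ∈ E

lemma norm_rayPoint_div_sqrt {t : ℝ} (ht : 0 ≤ t) (y z : ℝ) :
    ‖rayPoint (t / √(1 + y ^ 2 + z ^ 2)) y z‖ = t := by
  have hN : 0 < 1 + y ^ 2 + z ^ 2 := by positivity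
  rw [EuclideanSpace.norm_eq, Real.sqrt_eq_iff_eq_sq (by positivity) ht, Fin.sum_univ_three]
  simp only [rayPoint, Real.norm_eq_abs, sq_abs]
  simp only [Matrix.cons_val_zero, Matrix.cons_val_one, Matrix.cons_val]
  simp only [mul_pow, div_pow, Real.sq_sqrt hN.le]
  field_simp

lemma hasPeriodicRays_sphereUnion {p : ℝ} : HasPeriodicRays p (sphereUnion p) := by
  refine ⟨1, le_rfl, fun y _ z _ => ⟨0, by simp, fun k hk => mem_sphereUnion_iff.2 ⟨k, hk, ?_⟩⟩⟩
  rw [zero_add, one_mul, norm_rayPoint_div_sqrt (by positivity)]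

lemma hasPeriodicRays_spiralShell {p : ℝ} : HasPeriodicRays p (spiralShell p) := by
  have hpi := Real.pi_gt_three
  refine ⟨2 * Real.pi, by linarith, fun y hy z _ => ⟨Real.arctan y,
    ⟨Real.arctan_nonneg.2 hy.1, by linarith [Real.arctan_lt_pi_div_two y]⟩, fun k hk =>
    mem_spiralShell_iff.2 ⟨Real.arctan y + 2 * Real.pi * k,
      Real.arccos (z / √(1 + y ^ 2 + z ^ 2)) + 2 * Real.pi, ?_, ?_, ?_⟩⟩⟩
  · have : (1 : ℝ) ≤ k := by exact_mod_cast hk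
    nlinarith [Real.arctan_nonneg.2 hy.1]
  · linarith [Real.arccos_nonneg (z / √(1 + y ^ 2 + z ^ 2))]
  · set N := √(1 + y ^ 2 + z ^ 2) with hN
    have hN2 : N ^ 2 = 1 + y ^ 2 + z ^ 2 := Real.sq_sqrt (by positivity)
    have hNpos : 0 < N := Real.sqrt_pos.2 (by positivity)
    have hY : 0 < √(1 + y ^ 2) := Real.sqrt_pos.2 (by positivity)
    have hz : |z / N| ≤ 1 := by
      rw [abs_div, abs_of_pos hNpos, div_le_one hNpos]
      exact Real.abs_le_sqrt (by nlinarith)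
    have hsin : Real.sin (Real.arccos (z / N)) = √(1 + y ^ 2) / N := by
      rw [Real.sin_arccos, Real.sqrt_eq_iff_eq_sq
        (sub_nonneg.2 ((sq_le_one_iff_abs_le_one _).2 hz)) (by positivity), div_pow, div_pow,
        hN2, Real.sq_sqrt (show (0 : ℝ) ≤ 1 + y ^ 2 by positivity)]
      field_simp
      ring
    rw [abs_le] at hz
    have hper : 2 * Real.pi * (k : ℝ) = k * (2 * Real.pi) := by ring
    ext i
    fin_cases i <;> simp only [rayPoint, spherical, Real.sin_add_two_pi, Real.cos_add_two_pi, hsin,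
      Real.cos_arccos hz.1 hz.2, hper, Real.cos_add_nat_mul_two_pi, Real.sin_add_nat_mul_two_pi,
      Real.cos_arctan, Real.sin_arctan] <;> simp <;> field_simp

lemma rayPoint_sub_lt_of_floor_eq {r s y z s' y' z' : ℝ} (hr : 0 < r) (hs : 0 < s)
    (hy : |y'| ≤ 1) (hz : |z'| ≤ 1)
    (h : (fun i => ⌊rayPoint s y z i / r⌋) = fun i => ⌊rayPoint s' y' z' i / r⌋) :
    |s - s'| < r ∧ s * |y - y'| < 2 * r ∧ s * |z - z'| < 2 * r := by
  have h1 : ∀ i, |rayPoint s y z i - rayPoint s' y' z' i| < r := fun i => by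
    have := Int.abs_sub_lt_one_of_floor_eq_floor (congrFun h i)
    rwa [← sub_div, abs_div, abs_of_pos hr, div_lt_one hr] at this
  have h0 : |s - s'| < r := h1 0
  have hkey : ∀ w w' : ℝ, |w'| ≤ 1 → |s * w - s' * w'| < r → s * |w - w'| < 2 * r := by
    intro w w' hw hlt
    calc s * |w - w'| = |(s * w - s' * w') + (s' - s) * w'| := by
          rw [← abs_of_pos hs, ← abs_mul, abs_of_pos hs]; congr 1; ring
      _ ≤ |s * w - s' * w'| + |s - s'| * |w'| := by
          rw [abs_sub_comm s, ← abs_mul]; exact abs_add_le _ _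
      _ < 2 * r := by nlinarith [abs_nonneg (s - s')]
  exact ⟨h0, hkey y y' hy (h1 1), hkey z z' hz (h1 2)⟩

lemma half_le_floor {x : ℝ} (hx : 1 ≤ x) : x / 2 ≤ (⌊x⌋₊ : ℝ) := by
  have h1 : (1 : ℝ) ≤ ⌊x⌋₊ := by exact_mod_cast (Nat.one_le_floor_iff x).2 hx
  linarith [Nat.lt_floor_add_one x]

lemma eq_of_mul_abs_natCast_mul_sub_lt {s h b : ℝ} {i j : ℕ} (hs : 0 < s) (hh : 0 < h)
    (hb : b ≤ s * h) (hlt : s * |(i : ℝ) * h - j * h| < b) : i = j := by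
  by_contra hne
  have h1 : (1 : ℝ) ≤ |(i : ℝ) - j| := by
    have : (1 : ℤ) ≤ |(i : ℤ) - j| := Int.one_le_abs (sub_ne_zero.2 (by exact_mod_cast hne))
    exact_mod_cast this
  rw [← sub_mul, abs_mul, abs_of_pos hh] at hlt
  have h2 : h ≤ |(i : ℝ) - j| * h := by nlinarith
  nlinarith

lemma rpow_neg_sub_ge_of_lt {p ω β X : ℝ} {k l : ℕ} (hp : 0 < p) (hω : 0 < ω) (hβ : 0 ≤ β)
    (hk : 1 ≤ k) (hkl : k < l) (hX : β + ω * l ≤ X) :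
    p * ω * X ^ (-p - 1) ≤ (β + ω * k) ^ (-p) - (β + ω * l) ^ (-p) := by
  have hk' : (1 : ℝ) ≤ k := by exact_mod_cast hk
  have hkl' : (k : ℝ) + 1 ≤ l := by exact_mod_cast hkl
  have h0 : 0 < β + ω * k := by positivity
  have hkl2 : ω * (k + 1) ≤ ω * l := by gcongr
  have hl0 : 0 < β + ω * l := by linarith
  have hX0 : 0 < X := by linarith
  refine (rpow_neg_sub_rpow_neg_bounds hp h0 (by linarith)).1.trans' ?_
  have h2 := Real.rpow_le_rpow_of_nonpos hl0 hX (z := -p - 1) (by linarith)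
  calc p * ω * X ^ (-p - 1) = p * X ^ (-p - 1) * ω := by ring
    _ ≤ p * (β + ω * l) ^ (-p - 1) * (β + ω * l - (β + ω * k)) := by
        gcongr
        linarith

/-- A set with periodic rays meets at least a constant multiple of `n * (n ^ (-p) / r) ^ 2` mesh
cubes in the ball of radius `n ^ (-p)`, as long as `r` is small compared to `n ^ (-p - 1)`. -/
lemma HasPeriodicRays.exists_mul_le_meshCubeCount {p : ℝ} (hp : 0 < p) {E : Set (Euc 3)}
    (hE : HasPeriodicRays p E) :
    ∃ K c : ℝ, 1 ≤ K ∧ 0 < c ∧ ∀ n : ℕ, 1 ≤ n → ∀ r : ℝ, 0 < r → K * r ≤ (n : ℝ) ^ (-p - 1) →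
      c * (n * ((n : ℝ) ^ (-p) / r) ^ 2) ≤
        meshCubeCount 3 r (closedBall 0 ((n : ℝ) ^ (-p)) ∩ E) := by
  obtain ⟨ω, hω, hrays⟩ := hE
  choose! β hβ hmem using hrays
  have hω0 : 0 < ω := by linarith
  set L : ℝ := 4 * (3 * ω) ^ p with hL
  have hL0 : 0 < L := by positivity
  set G : ℝ := 2 * (3 * ω) ^ (p + 1) / (p * ω) with hG
  have hG0 : 0 < G := by positivity
  refine ⟨1 + L + G, 1 / (4 * L ^ 2), by linarith, by positivity, fun n hn r hr hK => ?_⟩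
  have hn1 : (1 : ℝ) ≤ n := by exact_mod_cast hn
  have hn0 : (0 : ℝ) < n := by linarith
  have hLr : L * r ≤ (n : ℝ) ^ (-p) := by
    have h1 : (n : ℝ) ^ (-p - 1) ≤ (n : ℝ) ^ (-p) :=
      Real.rpow_le_rpow_of_exponent_le hn1 (by linarith)
    nlinarith
  have hGr : 2 * r ≤ p * ω * (3 * ω * n) ^ (-p - 1) := by
    have h1 : G * r ≤ (n : ℝ) ^ (-p - 1) := by nlinarith
    calc 2 * r = p * ω * (3 * ω) ^ (-p - 1) * (G * r) := by
          rw [hG, show -p - 1 = -(p + 1) by ring, Real.rpow_neg (by positivity)]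
          field_simp
      _ ≤ p * ω * (3 * ω) ^ (-p - 1) * (n : ℝ) ^ (-p - 1) := by gcongr
      _ = _ := by rw [Real.mul_rpow (by positivity) hn0.le]; ring
  set h : ℝ := L * r / (n : ℝ) ^ (-p) with hh
  have hnp : 0 < (n : ℝ) ^ (-p) := by positivity
  have hh0 : 0 < h := by positivity
  have hh1 : h ≤ 1 := (div_le_one hnp).2 hLr
  set m : ℕ := ⌊1 / h⌋₊ with hm
  have hm_mem : ∀ i < m, (i : ℝ) * h ∈ Icc (0 : ℝ) 1 := fun i hi => by
    refine ⟨by positivity, ?_⟩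
    rw [← le_div_iff₀ hh0]
    refine le_trans ?_ (Nat.floor_le (by positivity))
    exact_mod_cast hi.le
  set t : ℕ → ℕ → ℕ → ℝ := fun k i l => (β (i * h) (l * h) + ω * (n + k : ℕ)) ^ (-p) with ht
  set N : ℕ → ℕ → ℝ := fun i l => √(1 + (i * h) ^ 2 + (l * h) ^ 2) with hN
  set P : ℕ × ℕ × ℕ → Euc 3 := fun q =>
    rayPoint (t q.1 q.2.1 q.2.2 / N q.2.1 q.2.2) (q.2.1 * h) (q.2.2 * h) with hP
  have hN0 : ∀ i l, 0 < N i l := fun i l => Real.sqrt_pos.2 (by positivity)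
  have hN2 : ∀ i < m, ∀ l < m, N i l ≤ 2 := fun i hi l hl => by
    rw [hN, Real.sqrt_le_left zero_le_two]
    have := hm_mem i hi
    have := hm_mem l hl
    simp only [mem_Icc] at *
    nlinarith
  have hlow : ∀ i < m, ∀ l < m, ∀ k, (n : ℝ) ≤ β (i * h) (l * h) + ω * (n + k : ℕ) := by
    intro i hi l hl k
    have := (hβ _ (hm_mem i hi) _ (hm_mem l hl)).1
    push_cast
    nlinarith [Nat.cast_nonneg (α := ℝ) k]
  have hupp : ∀ i < m, ∀ l < m, ∀ k < n, β (i * h) (l * h) + ω * (n + k : ℕ) ≤ 3 * ω * n := by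
    intro i hi l hl k hk
    have := (hβ _ (hm_mem i hi) _ (hm_mem l hl)).2
    have hk' : (k : ℝ) ≤ n := by exact_mod_cast hk.le
    push_cast
    nlinarith
  have ht0 : ∀ i < m, ∀ l < m, ∀ k, 0 < t k i l := fun i hi l hl k =>
    Real.rpow_pos_of_pos (hn0.trans_le (hlow i hi l hl k)) _
  have htn : ∀ i < m, ∀ l < m, ∀ k, t k i l ≤ (n : ℝ) ^ (-p) := fun i hi l hl k =>
    Real.rpow_le_rpow_of_nonpos hn0 (hlow i hi l hl k) (by linarith)
  have hth : ∀ i < m, ∀ l < m, ∀ k < n, 2 * r ≤ t k i l / N i l * h := by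
    intro i hi l hl k hk
    have h1 : (3 * ω * n) ^ (-p) ≤ t k i l :=
      Real.rpow_le_rpow_of_nonpos (hn0.trans_le (hlow i hi l hl k)) (hupp i hi l hl k hk)
        (by linarith)
    calc 2 * r = (3 * ω * n) ^ (-p) / 2 * h := by
          rw [Real.mul_rpow (by positivity) hn0.le, hh, hL, Real.rpow_neg (by positivity)]
          field_simp
          norm_num
      _ ≤ t k i l / N i l * h := by
          have := hN2 i hi l hl
          have := hN0 i l
          have := ht0 i hi l hl k
          gcongr
  set S : Finset (ℕ × ℕ × ℕ) := Finset.range n ×ˢ (Finset.range m ×ˢ Finset.range m) with hS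
  have hinj : InjOn (fun q i => ⌊P q i / r⌋) (S : Set (ℕ × ℕ × ℕ)) := by
    rintro ⟨k, i, l⟩ hq ⟨k', i', l'⟩ hq' heq
    simp only [hS, Finset.coe_product, Finset.coe_range, mem_prod, mem_Iio] at hq hq'
    obtain ⟨hk, hi, hl⟩ := hq
    obtain ⟨hk', hi', hl'⟩ := hq'
    have hs : 0 < t k i l / N i l := div_pos (ht0 i hi l hl k) (hN0 i l)
    have habs : ∀ j < m, |(j : ℝ) * h| ≤ 1 := fun j hj => by
      rw [abs_of_nonneg (hm_mem j hj).1]; exact (hm_mem j hj).2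
    obtain ⟨h1, h2, h3⟩ := rayPoint_sub_lt_of_floor_eq hr hs (habs i' hi') (habs l' hl') heq
    obtain rfl := eq_of_mul_abs_natCast_mul_sub_lt hs hh0 (hth i hi l hl k hk) h2
    obtain rfl := eq_of_mul_abs_natCast_mul_sub_lt hs hh0 (hth i hi l hl k hk) h3
    simp only at h1
    rw [← sub_div, abs_div, abs_of_pos (hN0 i l), div_lt_iff₀ (hN0 i l)] at h1
    have h4 : |t k i l - t k' i l| < 2 * r := by nlinarith [hN2 i hi l hl]
    rw [abs_lt] at h4
    have hsep : ∀ a b : ℕ, a < b → b < n → 2 * r ≤ t a i l - t b i l := fun a b hab hb =>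
      hGr.trans (rpow_neg_sub_ge_of_lt hp hω0 (hβ _ (hm_mem i hi) _ (hm_mem l hl)).1 (by omega)
        (by omega) (hupp i hi l hl b hb))
    have hkk : k = k' := by
      rcases lt_trichotomy k k' with hlt | heq | hlt
      · linarith [hsep k k' hlt hk']
      · exact heq
      · linarith [hsep k' k hlt hk]
    rw [hkk]
  have hcard : ((n * (m * m) : ℕ) : ℝ) ≤
      meshCubeCount 3 r (closedBall 0 ((n : ℝ) ^ (-p)) ∩ E) := by
    rw [meshCubeCount_eq_ncard_image hr, Nat.cast_le]
    calc n * (m * m) = (S : Set (ℕ × ℕ × ℕ)).ncard := by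
          rw [ncard_coe_finset, hS, Finset.card_product, Finset.card_product, Finset.card_range,
            Finset.card_range]
      _ = ((fun q i => ⌊P q i / r⌋) '' (S : Set (ℕ × ℕ × ℕ))).ncard :=
          hinj.ncard_image.symm
      _ ≤ _ := by
          refine ncard_le_ncard ?_
            (finite_image_floor hr (isBounded_closedBall.subset inter_subset_left))
          rintro _ ⟨⟨k, i, l⟩, hq, rfl⟩
          simp only [hS, Finset.coe_product, Finset.coe_range, mem_prod, mem_Iio] at hq
          obtain ⟨hk, hi, hl⟩ := hq
          refine ⟨P (k, i, l), ⟨?_, hmem _ (hm_mem i hi) _ (hm_mem l hl) _ (by omega)⟩, rfl⟩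
          rw [mem_closedBall_zero_iff]
          exact (norm_rayPoint_div_sqrt (ht0 i hi l hl k).le _ _).trans_le (htn i hi l hl k)
  refine le_trans ?_ hcard
  have hm2 : 1 / h / 2 ≤ m := half_le_floor ((one_le_div hh0).2 hh1)
  push_cast
  calc 1 / (4 * L ^ 2) * (n * ((n : ℝ) ^ (-p) / r) ^ 2) = n * ((1 / h / 2) * (1 / h / 2)) := by
        rw [hh]; field_simp; norm_num
    _ ≤ n * (m * m) := by gcongr

lemma HasPeriodicRays.exists_mul_sq_le_mul {p : ℝ} (hp : 0 < p) {E : Set (Euc 3)}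
    (hE : HasPeriodicRays p E) :
    ∃ K C : ℝ, 1 ≤ K ∧ 0 < C ∧ ∀ J R M i : ℝ, 2 * K ≤ J → 0 < R → 0 ≤ M →
      (∀ x ∈ E, (meshCubeCount 3 (J ^ (-p - 1)) (ball x R ∩ E) : ℝ) ≤ M) → 1 ≤ i → i ≤ J →
      i * (i ^ (-p) / J ^ (-p - 1)) ^ 2 ≤ C * (1 + i ^ (-p) / R) ^ 3 * M := by
  obtain ⟨K, c, hK, hc, hlow⟩ := hE.exists_mul_le_meshCubeCount hp
  have hK0 : 0 < K := by linarith
  set B : ℝ := (2 * K) ^ p with hB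
  have hB1 : 1 ≤ B := Real.one_le_rpow (by linarith) hp.le
  refine ⟨K, 2 * K * (2 ^ p) ^ 2 / c * (4 * B) ^ 3, hK, by positivity,
    fun J R M i hKJ hR hM hEM hi hiJ => ?_⟩
  have hJ0 : 0 < J := by linarith
  have hi0 : 0 < i := by linarith
  set r : ℝ := J ^ (-p - 1) with hr
  have hr0 : 0 < r := by positivity
  set n : ℕ := ⌈i / (2 * K)⌉₊ with hn
  have hn1 : 1 ≤ n := Nat.one_le_ceil_iff.2 (by positivity)
  have hn0 : (0 : ℝ) < n := by exact_mod_cast hn1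
  have hin : i / (2 * K) ≤ n := Nat.le_ceil _
  have hni : (n : ℝ) < i / (2 * K) + 1 := Nat.ceil_lt_add_one (by positivity)
  have hnJ : (n : ℝ) ≤ J / K := by
    have h1 : i / (2 * K) ≤ J / (2 * K) := by gcongr
    have h2 : 1 ≤ J / (2 * K) := (one_le_div (by positivity)).2 hKJ
    have h3 : J / K = J / (2 * K) + J / (2 * K) := by field_simp; norm_num
    linarith
  have hn2 : (n : ℝ) ≤ 2 * i := by
    have h1 : i / (2 * K) ≤ i := div_le_self hi0.le (by linarith)
    linarith
  have hKr : K * r ≤ (n : ℝ) ^ (-p - 1) := by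
    calc K * r ≤ K ^ (p + 1) * r := by
          gcongr
          exact Real.self_le_rpow_of_one_le hK (by linarith)
      _ = (J / K) ^ (-p - 1) := by
          rw [Real.div_rpow hJ0.le hK0.le, show -p - 1 = -(p + 1) by ring,
            Real.rpow_neg hK0.le, hr, show -p - 1 = -(p + 1) by ring]
          field_simp
      _ ≤ _ := Real.rpow_le_rpow_of_nonpos hn0 hnJ (by linarith)
  have hmain := (hlow n hn1 r hr0 hKr).trans
    (meshCubeCount_closedBall_inter_le hr0 hR (by positivity) hM hEM)
  have hnB : (n : ℝ) ^ (-p) ≤ B * i ^ (-p) := by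
    calc (n : ℝ) ^ (-p) ≤ (i / (2 * K)) ^ (-p) :=
          Real.rpow_le_rpow_of_nonpos (by positivity) hin (by linarith)
      _ = B * i ^ (-p) := by
          rw [Real.div_rpow hi0.le (by positivity), Real.rpow_neg (by positivity : 0 ≤ 2 * K), hB]
          field_simp
  have hn2p : i ^ (-p) ≤ 2 ^ p * (n : ℝ) ^ (-p) := by
    calc i ^ (-p) = 2 ^ p * (2 * i) ^ (-p) := by
          rw [Real.mul_rpow zero_le_two hi0.le, Real.rpow_neg zero_le_two]
          field_simp
      _ ≤ _ := by
          have := Real.rpow_le_rpow_of_nonpos hn0 hn2 (neg_nonpos.2 hp.le)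
          gcongr
  have hbase : 4 * (n : ℝ) ^ (-p) / R + 2 ≤ 4 * B * (1 + i ^ (-p) / R) := by
    have h1 : 4 * (n : ℝ) ^ (-p) / R ≤ 4 * (B * i ^ (-p)) / R := by gcongr
    have h2 : 4 * B * (1 + i ^ (-p) / R) = 4 * B + 4 * (B * i ^ (-p)) / R := by ring
    linarith
  have hi2 : i ≤ 2 * K * n := by
    rw [div_le_iff₀ (by positivity)] at hin
    linarith
  calc i * (i ^ (-p) / r) ^ 2 ≤ 2 * K * n * (2 ^ p * (n : ℝ) ^ (-p) / r) ^ 2 := by gcongr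
    _ = 2 * K * (2 ^ p) ^ 2 / c * (c * (n * ((n : ℝ) ^ (-p) / r) ^ 2)) := by field_simp
    _ ≤ 2 * K * (2 ^ p) ^ 2 / c * ((4 * B * (1 + i ^ (-p) / R)) ^ 3 * M) := by
        refine mul_le_mul_of_nonneg_left (hmain.trans ?_) (by positivity)
        gcongr
    _ = _ := by ring

lemma sum_Icc_floor_one_div_le {J : ℝ} (hJ : 1 ≤ J) :
    ∑ j ∈ Finset.Icc 1 ⌊J⌋₊, 1 / (j : ℝ) ≤ 1 + Real.log J := by
  have h1 := harmonic_floor_le_one_add_log J hJ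
  rw [harmonic_eq_sum_Icc] at h1
  push_cast at h1
  simpa using h1

/-- A uniform bound for the mesh counts of balls in a set with periodic rays gives, up to a
logarithm, a uniform bound at the same scales for every set with thin layers. -/
lemma HasPeriodicRays.exists_meshCubeCount_le {p : ℝ} (hp : 0 < p) {E F : Set (Euc 3)}
    (hE : HasPeriodicRays p E) (hF : HasThinLayers p F) :
    ∃ K C : ℝ, 1 ≤ K ∧ 0 < C ∧ ∀ J R M : ℝ, 2 * K ≤ J → J ^ (-p - 1) ≤ R → 0 ≤ M →
      (∀ x ∈ E, (meshCubeCount 3 (J ^ (-p - 1)) (ball x R ∩ E) : ℝ) ≤ M) →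
      ∀ x : Euc 3, (meshCubeCount 3 (J ^ (-p - 1)) (ball x R ∩ F) : ℝ) ≤
        C * M * (1 + Real.log J) := by
  obtain ⟨K, C, hK, hC, hkey⟩ := hE.exists_mul_sq_le_mul hp
  obtain ⟨A, hA, T, hFT, hTball, hTcount⟩ := hF
  refine ⟨K, 512 * C + 32 * A * C, hK, by positivity, fun J R M hKJ hrR hM hEM x => ?_⟩
  have hJ1 : 1 ≤ J := by linarith
  have hJ0 : 0 < J := by linarith
  have hlog : 0 ≤ Real.log J := Real.log_nonneg hJ1
  set r : ℝ := J ^ (-p - 1) with hr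
  have hr0 : 0 < r := by positivity
  have hR : 0 < R := hr0.trans_le hrR
  have hτ0 : 0 < J ^ (-p) := by positivity
  have hτ : J ^ (-p) = J * r := by
    rw [hr, ← Real.rpow_one_add' hJ0.le (by linarith)]
    ring_nf
  have hrτ : r ≤ J ^ (-p) := by nlinarith
  have hJ3 : J ^ 3 ≤ C * (1 + J ^ (-p) / R) ^ 3 * M := by
    refine le_trans (le_of_eq ?_) (hkey J R M J hKJ hR hM hEM hJ1 le_rfl)
    rw [hτ, ← hr]
    field_simp
  rcases le_or_gt R (J ^ (-p)) with hRτ | hRτ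
  · have h1 : 1 ≤ J ^ (-p) / R := (one_le_div hR).2 hRτ
    have h2 : 1 ≤ R / r := (one_le_div hr0).2 hrR
    calc (meshCubeCount 3 r (ball x R ∩ F) : ℝ) ≤ (2 * R / r + 2) ^ 3 :=
          meshCubeCount_le_of_subset_closedBall hr0 hR.le
            (inter_subset_left.trans ball_subset_closedBall)
      _ ≤ (4 * (R / r)) ^ 3 := by
          gcongr
          rw [mul_div_assoc]
          linarith
      _ = 64 * (R / J ^ (-p)) ^ 3 * J ^ 3 := by
          rw [hτ]
          field_simp
          norm_num
      _ ≤ 64 * (R / J ^ (-p)) ^ 3 * (C * (2 * (J ^ (-p) / R)) ^ 3 * M) := by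
          gcongr
          refine hJ3.trans ?_
          gcongr
          linarith
      _ = 512 * C * M := by
          field_simp
          ring
      _ ≤ (512 * C + 32 * A * C) * M * (1 + Real.log J) := by
          have h3 : 0 ≤ 32 * A * C * M := by positivity
          have h4 : 0 ≤ (512 * C + 32 * A * C) * M * Real.log J := by positivity
          linarith
  · have hlayer : ∀ j ∈ Finset.Icc 1 ⌊J⌋₊,
        (meshCubeCount 3 r (ball x R ∩ T j) : ℝ) ≤ 32 * A * C * M * (1 / (j : ℝ)) := by
      intro j hj
      rw [Finset.mem_Icc] at hj
      have hj1 : (1 : ℝ) ≤ j := by exact_mod_cast hj.1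
      have hj0 : (0 : ℝ) < j := by linarith
      have hjJ : (j : ℝ) ≤ J := (Nat.le_floor_iff hJ0.le).1 hj.2
      have hjτ : J ^ (-p) ≤ (j : ℝ) ^ (-p) :=
        Real.rpow_le_rpow_of_nonpos hj0 hjJ (by linarith)
      set m : ℝ := min R ((j : ℝ) ^ (-p)) with hm
      have hrm : r ≤ m := le_min hrR (hrτ.trans hjτ)
      obtain ⟨i, hji, hiJ, him⟩ : ∃ i, (j : ℝ) ≤ i ∧ i ≤ J ∧ i ^ (-p) = m := by
        rcases le_total ((j : ℝ) ^ (-p)) R with h | h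
        · exact ⟨j, le_rfl, hjJ, (min_eq_right h).symm⟩
        · have hcancel : ∀ s : ℝ, 0 ≤ s → (s ^ (-p)) ^ (-p)⁻¹ = s := fun s hs =>
            Real.rpow_rpow_inv hs (by linarith)
          have hp' : (-p)⁻¹ ≤ 0 := inv_nonpos.2 (by linarith)
          refine ⟨R ^ (-p)⁻¹, ?_, ?_, ?_⟩
          · rw [← hcancel j hj0.le]
            exact Real.rpow_le_rpow_of_nonpos hR h hp'
          · rw [← hcancel J hJ0.le]
            exact Real.rpow_le_rpow_of_nonpos hτ0 hRτ.le hp'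
          · rw [Real.rpow_inv_rpow hR.le (by linarith), hm, min_eq_left h]
      have h1 : j * (m / r) ^ 2 ≤ 8 * C * M := by
        have h2 := hkey J R M i hKJ hR hM hEM (hj1.trans hji) hiJ
        rw [him, ← hr] at h2
        calc j * (m / r) ^ 2 ≤ i * (m / r) ^ 2 := by gcongr
          _ ≤ C * (1 + m / R) ^ 3 * M := h2
          _ ≤ C * (1 + 1) ^ 3 * M := by
              have : m / R ≤ 1 := (div_le_one hR).2 (min_le_left _ _)
              have : 0 ≤ m := hr0.le.trans hrm
              gcongr
          _ = 8 * C * M := by ring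
      have h2 : ∀ y ∈ ball x R ∩ T j, ∀ z ∈ ball x R ∩ T j, dist y z ≤ 2 * m := by
        intro y hy z hz
        rw [hm, mul_min_of_nonneg _ _ zero_le_two, two_mul, two_mul]
        refine le_min ?_ ?_
        · exact (dist_triangle_right y z x).trans (add_le_add hy.1.le hz.1.le)
        · exact (dist_triangle_right y z 0).trans
            (add_le_add (hTball j hj.1 hy.2) (hTball j hj.1 hz.2))
      calc (meshCubeCount 3 r (ball x R ∩ T j) : ℝ) ≤ A * (2 * m / r) ^ 2 :=
            hTcount j hj.1 r (2 * m) hr0 (by linarith) _ inter_subset_right h2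
        _ = 4 * A * (j * (m / r) ^ 2) * (1 / (j : ℝ)) := by field_simp; ring
        _ ≤ 4 * A * (8 * C * M) * (1 / (j : ℝ)) := by gcongr
        _ = _ := by ring
    have hcore : (meshCubeCount 3 r (closedBall (0 : Euc 3) (J ^ (-p))) : ℝ) ≤ 512 * C * M := by
      calc (meshCubeCount 3 r (closedBall (0 : Euc 3) (J ^ (-p))) : ℝ)
          ≤ (2 * J ^ (-p) / r + 2) ^ 3 :=
            meshCubeCount_le_of_subset_closedBall hr0 hτ0.le Subset.rfl
        _ = (2 * J + 2) ^ 3 := by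
            rw [hτ]
            field_simp
        _ ≤ (4 * J) ^ 3 := by
            gcongr
            linarith
        _ = 64 * J ^ 3 := by ring
        _ ≤ 64 * (C * (1 + 1) ^ 3 * M) := by
            have : J ^ (-p) / R ≤ 1 := (div_le_one hR).2 hRτ.le
            gcongr
            refine hJ3.trans ?_
            gcongr
        _ = _ := by ring
    have hcover : ball x R ∩ F ⊆
        closedBall 0 (J ^ (-p)) ∪ ⋃ j ∈ Finset.Icc 1 ⌊J⌋₊, ball x R ∩ T j := by
      rintro y ⟨hyx, hyF⟩
      obtain ⟨j, hj, hyj⟩ := hFT y hyF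
      rcases le_or_gt j ⌊J⌋₊ with h | h
      · exact Or.inr (mem_biUnion (Finset.mem_Icc.2 ⟨hj, h⟩) ⟨hyx, hyj⟩)
      · refine Or.inl (closedBall_subset_closedBall ?_ (hTball j hj hyj))
        exact Real.rpow_le_rpow_of_nonpos hJ0 ((Nat.floor_lt hJ0.le).1 h).le (by linarith)
    have hbdd : Bornology.IsBounded
        (closedBall (0 : Euc 3) (J ^ (-p)) ∪ ⋃ j ∈ Finset.Icc 1 ⌊J⌋₊, ball x R ∩ T j) :=
      isBounded_closedBall.union ((isBounded_ball (x := x) (r := R)).subset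
        (iUnion₂_subset fun _ _ => inter_subset_left))
    have hsum : meshCubeCount 3 r (ball x R ∩ F) ≤
        meshCubeCount 3 r (closedBall (0 : Euc 3) (J ^ (-p))) +
          ∑ j ∈ Finset.Icc 1 ⌊J⌋₊, meshCubeCount 3 r (ball x R ∩ T j) :=
      ((meshCubeCount_mono hr0 hcover hbdd).trans (meshCubeCount_union_le hr0 _ _)).trans
        (by gcongr; exact meshCubeCount_biUnion_le hr0 _ _)
    calc (meshCubeCount 3 r (ball x R ∩ F) : ℝ)
        ≤ meshCubeCount 3 r (closedBall (0 : Euc 3) (J ^ (-p))) +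
          ∑ j ∈ Finset.Icc 1 ⌊J⌋₊, (meshCubeCount 3 r (ball x R ∩ T j) : ℝ) := by
          exact_mod_cast hsum
      _ ≤ 512 * C * M + ∑ j ∈ Finset.Icc 1 ⌊J⌋₊, 32 * A * C * M * (1 / (j : ℝ)) :=
          add_le_add hcore (Finset.sum_le_sum hlayer)
      _ ≤ 512 * C * M + 32 * A * C * M * (1 + Real.log J) := by
          rw [← Finset.mul_sum]
          gcongr
          exact sum_Icc_floor_one_div_le hJ1
      _ ≤ (512 * C + 32 * A * C) * M * (1 + Real.log J) := by
          have : 0 ≤ 512 * C * M * Real.log J := by positivity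
          linarith

/-- The admissible exponents in the definition of `assouadSpec`. -/
def assouadExponents (d : ℕ) (θ : ℝ) (E : Set (Euc d)) : Set ℝ :=
  {α : ℝ | 0 < α ∧ ∃ C : ℝ, 0 < C ∧ ∀ r : ℝ, 0 < r → r < 1 → ∀ x ∈ E,
    (meshCubeCount d r (ball x (r ^ θ) ∩ E) : ℝ) ≤ C * (r ^ (θ - 1)) ^ α}

lemma one_add_log_le_mul_rpow {r δ : ℝ} (hr : 0 < r) (hr1 : r ≤ 1) (hδ : 0 < δ) :
    1 + Real.log r⁻¹ ≤ (1 + δ⁻¹) * r ^ (-δ) := by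
  have h1 := Real.log_le_rpow_div (inv_nonneg.2 hr.le) hδ
  rw [Real.inv_rpow hr.le, ← Real.rpow_neg hr.le, div_eq_mul_inv] at h1
  have h2 : 1 ≤ r ^ (-δ) := Real.one_le_rpow_of_pos_of_le_one_of_nonpos hr hr1 (by linarith)
  linarith

lemma add_mem_assouadExponents {p θ : ℝ} (hp : 0 < p) (hθ : θ ∈ Ioo (0 : ℝ) 1)
    {E F : Set (Euc 3)} (hE : HasPeriodicRays p E) (hF : HasThinLayers p F) {α ε : ℝ}
    (hα : α ∈ assouadExponents 3 θ E) (hε : 0 < ε) : α + ε ∈ assouadExponents 3 θ F := by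
  obtain ⟨hα0, C₀, hC₀, hcount⟩ := hα
  obtain ⟨K, C, hK, hC, hle⟩ := hE.exists_meshCubeCount_le hp hF
  have hK0 : 0 < K := by linarith
  have hδ : 0 < (1 - θ) * ε := mul_pos (sub_pos.2 hθ.2) hε
  set δ : ℝ := (1 - θ) * ε with hδ_def
  set C₁ : ℝ := (2 * (2 * K) ^ (p + 1) + 2) ^ 3 with hC₁
  have hC₁0 : 0 < C₁ := by positivity
  refine ⟨by linarith, C₁ + C * C₀ * (1 + δ⁻¹), by positivity, fun r hr hr1 x _ => ?_⟩
  set X : ℝ := r ^ (θ - 1) with hX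
  have hX1 : 1 ≤ X :=
    Real.one_le_rpow_of_pos_of_le_one_of_nonpos hr hr1.le (by linarith [hθ.2])
  have hX0 : 0 < X := by linarith
  have hXα : 1 ≤ X ^ (α + ε) := Real.one_le_rpow hX1 (by linarith)
  set J : ℝ := r ^ (-p - 1)⁻¹ with hJ
  have hJ0 : 0 < J := by positivity
  have hJr : J ^ (-p - 1) = r := Real.rpow_inv_rpow hr.le (by linarith)
  rcases lt_or_ge J (2 * K) with hJK | hJK
  · have hR1 : r ^ θ ≤ 1 := Real.rpow_le_one hr.le hr1.le hθ.1.le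
    have hrK : 1 / r ≤ (2 * K) ^ (p + 1) := by
      have h1 := Real.rpow_le_rpow_of_nonpos hJ0 hJK.le (z := -p - 1) (by linarith)
      rw [hJr, show -p - 1 = -(p + 1) by ring, Real.rpow_neg (by positivity)] at h1
      rw [one_div]
      exact inv_le_of_inv_le₀ (by positivity) h1
    calc (meshCubeCount 3 r (ball x (r ^ θ) ∩ F) : ℝ) ≤ (2 * r ^ θ / r + 2) ^ 3 :=
          meshCubeCount_le_of_subset_closedBall hr (by positivity)
            (inter_subset_left.trans ball_subset_closedBall)
      _ ≤ (2 * 1 / r + 2) ^ 3 := by gcongr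
      _ ≤ C₁ := by
          rw [mul_div_assoc, hC₁]
          gcongr
      _ ≤ C₁ * X ^ (α + ε) := le_mul_of_one_le_right hC₁0.le hXα
      _ ≤ _ := by
          have : 0 ≤ C * C₀ * (1 + δ⁻¹) * X ^ (α + ε) := by positivity
          linarith
  · have hrR : r ≤ r ^ θ := Real.self_le_rpow_of_le_one hr.le hr1.le hθ.2.le
    have h1 := hle J (r ^ θ) (C₀ * X ^ α) hJK (by rwa [hJr]) (by positivity)
      (by rw [hJr]; exact hcount r hr hr1) x
    rw [hJr] at h1
    have hlogr : 0 ≤ Real.log r⁻¹ := Real.log_nonneg ((one_le_inv₀ hr).2 hr1.le)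
    have hlog : Real.log J ≤ Real.log r⁻¹ := by
      rw [hJ, Real.log_rpow hr, show (-p - 1)⁻¹ = -(p + 1)⁻¹ by rw [← inv_neg]; ring_nf]
      rw [Real.log_inv] at hlogr ⊢
      have : (p + 1)⁻¹ ≤ 1 := inv_le_one_of_one_le₀ (by linarith)
      nlinarith
    have hrX : r ^ (-δ) = X ^ ε := by
      rw [hX, ← Real.rpow_mul hr.le, hδ_def]
      ring_nf
    calc (meshCubeCount 3 r (ball x (r ^ θ) ∩ F) : ℝ)
        ≤ C * (C₀ * X ^ α) * (1 + Real.log J) := h1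
      _ ≤ C * (C₀ * X ^ α) * ((1 + δ⁻¹) * X ^ ε) := by
          gcongr
          rw [← hrX]
          exact (by linarith : 1 + Real.log J ≤ 1 + Real.log r⁻¹).trans
            (one_add_log_le_mul_rpow hr hr1.le hδ)
      _ = C * C₀ * (1 + δ⁻¹) * X ^ (α + ε) := by
          rw [Real.rpow_add hX0]
          ring
      _ ≤ _ := by
          have : 0 ≤ C₁ * X ^ (α + ε) := by positivity
          linarith

lemma csInf_le_csInf_of_add_mem {s t : Set ℝ} (ht : BddBelow t) (hs : s.Nonempty)
    (h : ∀ a ∈ s, ∀ ε : ℝ, 0 < ε → a + ε ∈ t) : sInf t ≤ sInf s :=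
  le_csInf hs fun a ha => le_of_forall_pos_le_add fun ε hε => csInf_le ht (h a ha ε hε)

lemma csInf_eq_csInf_of_add_mem {s t : Set ℝ} (hs : BddBelow s) (ht : BddBelow t)
    (hst : ∀ a ∈ s, ∀ ε : ℝ, 0 < ε → a + ε ∈ t) (hts : ∀ a ∈ t, ∀ ε : ℝ, 0 < ε → a + ε ∈ s) :
    sInf s = sInf t := by
  rcases s.eq_empty_or_nonempty with rfl | hs'
  · rw [t.eq_empty_of_forall_notMem fun a ha => hts a ha 1 one_pos]
  · obtain ⟨a, ha⟩ := id hs'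
    have ht' : t.Nonempty := ⟨a + 1, hst a ha 1 one_pos⟩
    exact le_antisymm (csInf_le_csInf_of_add_mem hs ht' hts)
      (csInf_le_csInf_of_add_mem ht hs' hst)

lemma bddBelow_assouadExponents (d : ℕ) (θ : ℝ) (E : Set (Euc d)) :
    BddBelow (assouadExponents d θ E) :=
  ⟨0, fun _ hα => hα.1.le⟩

/-- **Proposition (shells and concentric round spheres have the same Assouad spectrum).**
For `p > 0` and every `θ ∈ (0,1)`, `dim_A^θ 𝒮_p = dim_A^θ (⋃_{j ≥ 1} S(0, j^{-p}))`. -/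
theorem assouadSpec_spiralShell_eq_sphereUnion (p : ℝ) (hp : 0 < p) :
    ∀ θ : ℝ, θ ∈ Ioo (0 : ℝ) 1 →
      assouadSpec 3 θ (spiralShell p) = assouadSpec 3 θ (sphereUnion p) := by
  intro θ hθ
  exact csInf_eq_csInf_of_add_mem (bddBelow_assouadExponents 3 θ _)
    (bddBelow_assouadExponents 3 θ _)
    (fun _ hα _ hε => add_mem_assouadExponents hp hθ hasPeriodicRays_spiralShell
      (hasThinLayers_sphereUnion p) hα hε)
    (fun _ hα _ hε => add_mem_assouadExponents hp hθ hasPeriodicRays_sphereUnion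
      (hasThinLayers_spiralShell hp) hα hε)
end
end

section
/- Let p ≥ q > 0 and let 𝒮_p, 𝒮_q ⊆ ℝ³ be the corresponding polynomial spiral shells. Then there exists a homeomorphism F: ℝ³ → ℝ³ with F(𝒮_p ∪ {0}) = 𝒮_q ∪ {0} which is (q/p, p/q)-bi-Hölder on every compact set: for every compact E ⊆ ℝ³ there is a constant C > 0 such that C^{−1}|x − y|^{p/q} ≤ |F(x) − F(y)| ≤ C|x − y|^{q/p} for all x, y ∈ E. In particular, the radial stretch map F(0) = 0, F(x) = |x|^{q/p − 1} x has these properties. -/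
open Metric Set Filter MeasureTheory Topology
open scoped RealInnerProductSpace

noncomputable section

section RadialStretch

variable {V : Type*} [NormedAddCommGroup V]

/-- The radial stretch `x ↦ ‖x‖ ^ (a - 1) • x`. -/
def radialStretch [NormedSpace ℝ V] (a : ℝ) (x : V) : V := ‖x‖ ^ (a - 1) • x

lemma rpow_sub_one_mul_self {a r : ℝ} (ha : 0 < a) (hr : 0 ≤ r) : r ^ (a - 1) * r = r ^ a := by
  rcases hr.eq_or_lt with rfl | hr
  · simp [Real.zero_rpow ha.ne']
  · rw [Real.rpow_sub_one hr.ne', div_mul_cancel₀ _ hr.ne']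

lemma norm_radialStretch [NormedSpace ℝ V] {a : ℝ} (ha : 0 < a) (x : V) :
    ‖radialStretch a x‖ = ‖x‖ ^ a := by
  rw [radialStretch, norm_smul, Real.norm_of_nonneg (by positivity),
    rpow_sub_one_mul_self ha (norm_nonneg x)]

lemma radialStretch_radialStretch [NormedSpace ℝ V] {a b : ℝ} (ha : 0 < a) (hab : a * b = 1)
    (x : V) : radialStretch b (radialStretch a x) = x := by
  rcases eq_or_ne x 0 with rfl | hx
  · simp [radialStretch]
  · have hx' : 0 < ‖x‖ := norm_pos_iff.2 hx
    rw [radialStretch, norm_radialStretch ha, radialStretch, smul_smul, ← Real.rpow_mul hx'.le,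
      ← Real.rpow_add hx']
    have h : a * (b - 1) + (a - 1) = 0 := by linear_combination hab
    rw [h, Real.rpow_zero, one_smul]

lemma continuous_radialStretch [NormedSpace ℝ V] {a : ℝ} (ha : 0 < a) :
    Continuous (radialStretch a : V → V) := by
  rw [continuous_iff_continuousAt]
  intro x
  rcases eq_or_ne x 0 with rfl | hx
  · have h0 : radialStretch a (0 : V) = 0 := by simp [radialStretch]
    rw [ContinuousAt, h0, tendsto_zero_iff_norm_tendsto_zero]
    simp only [norm_radialStretch ha]
    have h : ContinuousAt (fun x : V => ‖x‖ ^ a) 0 :=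
      continuous_norm.continuousAt.rpow_const (Or.inr ha.le)
    simpa [ContinuousAt, Real.zero_rpow ha.ne'] using h
  · exact (continuous_norm.continuousAt.rpow_const (Or.inl (norm_ne_zero_iff.2 hx))).smul
      continuousAt_id

/-- The radial stretch as a homeomorphism, with inverse the stretch of reciprocal exponent. -/
def radialStretchHomeomorph [NormedSpace ℝ V] (a : ℝ) (ha : 0 < a) : V ≃ₜ V where
  toFun := radialStretch a
  invFun := radialStretch a⁻¹
  left_inv := radialStretch_radialStretch ha (mul_inv_cancel₀ ha.ne')
  right_inv := radialStretch_radialStretch (inv_pos.2 ha) (inv_mul_cancel₀ ha.ne')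
  continuous_toFun := continuous_radialStretch ha
  continuous_invFun := continuous_radialStretch (inv_pos.2 ha)

lemma abs_rpow_sub_rpow_le {a r s : ℝ} (ha : 0 < a) (ha1 : a ≤ 1) (hr : 0 ≤ r) (hs : 0 ≤ s) :
    |r ^ a - s ^ a| ≤ |r - s| ^ a := by
  wlog h : s ≤ r generalizing r s
  · rw [abs_sub_comm, abs_sub_comm r]
    exact this hs hr (le_of_not_ge h)
  rw [abs_of_nonneg (sub_nonneg.2 h),
    abs_of_nonneg (sub_nonneg.2 (Real.rpow_le_rpow hs h ha.le))]
  have := Real.rpow_add_le_add_rpow (sub_nonneg.2 h) hs ha.le ha1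
  rw [sub_add_cancel] at this
  linarith

lemma mul_abs_sub_le_abs_rpow_sub_rpow {a r s R : ℝ} (ha : 0 < a) (ha1 : a ≤ 1) (hr : 0 ≤ r)
    (hs : 0 ≤ s) (hrR : r ≤ R) (hsR : s ≤ R) :
    a * R ^ (a - 1) * |r - s| ≤ |r ^ a - s ^ a| := by
  wlog h : s ≤ r generalizing r s
  · rw [abs_sub_comm, abs_sub_comm (r ^ a)]
    exact this hs hr hsR hrR (le_of_not_ge h)
  rcases hr.eq_or_lt with rfl | hr
  · simp [le_antisymm h hs]
  rw [abs_of_nonneg (sub_nonneg.2 h),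
    abs_of_nonneg (sub_nonneg.2 (Real.rpow_le_rpow hs h ha.le))]
  have hB := rpow_one_add_le_one_add_mul_self (s := s / r - 1)
    (by linarith [div_nonneg hs hr.le]) ha.le ha1
  rw [add_sub_cancel, Real.div_rpow hs hr.le, div_le_iff₀ (by positivity)] at hB
  have hmul : a * r ^ (a - 1) * (r - s) ≤ r ^ a - s ^ a := by
    have : a * r ^ (a - 1) * (r - s) = r ^ a - (1 + a * (s / r - 1)) * r ^ a := by
      rw [Real.rpow_sub_one hr.ne']
      field_simp
      ring
    linarith
  have hpow : R ^ (a - 1) ≤ r ^ (a - 1) :=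
    Real.rpow_le_rpow_of_nonpos hr hrR (by linarith)
  refine le_trans ?_ hmul
  have := sub_nonneg.2 h
  gcongr

variable [InnerProductSpace ℝ V]

lemma norm_smul_sub_smul_sq (s t : ℝ) (x y : V) :
    ‖s • x - t • y‖ ^ 2 =
      (s * ‖x‖ - t * ‖y‖) ^ 2 + s * t * (2 * (‖x‖ * ‖y‖ - ⟪x, y⟫)) := by
  rw [norm_sub_sq_real, norm_smul, norm_smul, real_inner_smul_left, real_inner_smul_right,
    mul_pow, mul_pow, Real.norm_eq_abs, Real.norm_eq_abs, sq_abs, sq_abs]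
  ring

lemma norm_radialStretch_sub_sq {a : ℝ} (ha : 0 < a) (x y : V) :
    ‖radialStretch a x - radialStretch a y‖ ^ 2 = (‖x‖ ^ a - ‖y‖ ^ a) ^ 2 +
      ‖x‖ ^ (a - 1) * ‖y‖ ^ (a - 1) * (2 * (‖x‖ * ‖y‖ - ⟪x, y⟫)) := by
  rw [radialStretch, radialStretch, norm_smul_sub_smul_sq,
    rpow_sub_one_mul_self ha (norm_nonneg x), rpow_sub_one_mul_self ha (norm_nonneg y)]

lemma norm_sub_sq_eq_angular (x y : V) :
    ‖x - y‖ ^ 2 = (‖x‖ - ‖y‖) ^ 2 + 2 * (‖x‖ * ‖y‖ - ⟪x, y⟫) := by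
  simpa using norm_smul_sub_smul_sq 1 1 x y

lemma norm_radialStretch_sub_le {a : ℝ} (ha : 0 < a) (ha1 : a ≤ 1) (x y : V) :
    ‖radialStretch a x - radialStretch a y‖ ≤ 3 * ‖x - y‖ ^ a := by
  have hD : 0 ≤ ‖x - y‖ ^ a := by positivity
  have hrad : (‖x‖ ^ a - ‖y‖ ^ a) ^ 2 ≤ (‖x - y‖ ^ a) ^ 2 := by
    refine sq_le_sq' ?_ ?_ <;>
      linarith [abs_le.1 ((abs_rpow_sub_rpow_le ha ha1 (norm_nonneg x) (norm_nonneg y)).trans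
        (Real.rpow_le_rpow (abs_nonneg _) (abs_norm_sub_norm_le x y) ha.le))]
  have hang : ‖x‖ ^ (a - 1) * ‖y‖ ^ (a - 1) * (2 * (‖x‖ * ‖y‖ - ⟪x, y⟫)) ≤
      4 * (‖x - y‖ ^ a) ^ 2 := by
    set w := 2 * (‖x‖ * ‖y‖ - ⟪x, y⟫) with hw
    have hw0 : 0 ≤ w := by linarith [real_inner_le_norm x y]
    have hw4 : w ≤ 4 * (‖x‖ * ‖y‖) := by linarith [neg_le_of_abs_le (abs_real_inner_le_norm x y)]
    have hwD : w ≤ ‖x - y‖ ^ 2 := by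
      rw [norm_sub_sq_eq_angular]; linarith [sq_nonneg (‖x‖ - ‖y‖)]
    rcases hw0.eq_or_lt with h0 | hpos
    · rw [← h0, mul_zero]; positivity
    have hm : 0 < ‖x‖ * ‖y‖ := by linarith
    rw [← Real.mul_rpow (norm_nonneg x) (norm_nonneg y)]
    have h1 : (‖x‖ * ‖y‖) ^ (a - 1) ≤ (w / 4) ^ (a - 1) :=
      Real.rpow_le_rpow_of_nonpos (by positivity) (by linarith) (by linarith)
    calc (‖x‖ * ‖y‖) ^ (a - 1) * w ≤ (w / 4) ^ (a - 1) * w := by gcongr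
      _ = 4 * (w / 4) ^ a := by
        rw [← rpow_sub_one_mul_self ha (by positivity : 0 ≤ w / 4)]; ring
      _ ≤ 4 * (‖x - y‖ ^ 2) ^ a := by
        have : w / 4 ≤ ‖x - y‖ ^ 2 := by linarith
        gcongr
      _ = 4 * (‖x - y‖ ^ a) ^ 2 := by rw [Real.rpow_pow_comm (norm_nonneg _)]
  refine (sq_le_sq₀ (by positivity) (by positivity)).1 ?_
  rw [norm_radialStretch_sub_sq ha]
  nlinarith

lemma mul_norm_sub_le_norm_radialStretch_sub {a R : ℝ} (ha : 0 < a) (ha1 : a ≤ 1) (hR : 0 < R)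
    {x y : V} (hx : ‖x‖ ≤ R) (hy : ‖y‖ ≤ R) :
    a * R ^ (a - 1) * ‖x - y‖ ≤ ‖radialStretch a x - radialStretch a y‖ := by
  have hrad : (a * R ^ (a - 1)) ^ 2 * (‖x‖ - ‖y‖) ^ 2 ≤ (‖x‖ ^ a - ‖y‖ ^ a) ^ 2 := by
    rw [← mul_pow, sq_le_sq, abs_mul, abs_of_pos (by positivity : 0 < a * R ^ (a - 1))]
    exact mul_abs_sub_le_abs_rpow_sub_rpow ha ha1 (norm_nonneg x) (norm_nonneg y) hx hy
  have hang : (a * R ^ (a - 1)) ^ 2 * (2 * (‖x‖ * ‖y‖ - ⟪x, y⟫)) ≤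
      ‖x‖ ^ (a - 1) * ‖y‖ ^ (a - 1) * (2 * (‖x‖ * ‖y‖ - ⟪x, y⟫)) := by
    rcases eq_or_ne x 0 with rfl | hx0
    · simp
    rcases eq_or_ne y 0 with rfl | hy0
    · simp
    have hw0 : 0 ≤ 2 * (‖x‖ * ‖y‖ - ⟪x, y⟫) := by linarith [real_inner_le_norm x y]
    refine mul_le_mul_of_nonneg_right ?_ hw0
    have h1 : R ^ (a - 1) ≤ ‖x‖ ^ (a - 1) :=
      Real.rpow_le_rpow_of_nonpos (norm_pos_iff.2 hx0) hx (by linarith)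
    have h2 : R ^ (a - 1) ≤ ‖y‖ ^ (a - 1) :=
      Real.rpow_le_rpow_of_nonpos (norm_pos_iff.2 hy0) hy (by linarith)
    calc (a * R ^ (a - 1)) ^ 2 ≤ (1 * R ^ (a - 1)) ^ 2 := by gcongr
      _ = R ^ (a - 1) * R ^ (a - 1) := by ring
      _ ≤ _ := by gcongr
  refine (sq_le_sq₀ (by positivity) (by positivity)).1 ?_
  rw [norm_radialStretch_sub_sq ha, mul_pow, norm_sub_sq_eq_angular, mul_add]
  exact add_le_add hrad hang

lemma exists_biHolder_radialStretch {a b : ℝ} (ha : 0 < a) (ha1 : a ≤ 1) (hb1 : 1 ≤ b)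
    {E : Set V} (hE : Bornology.IsBounded E) :
    ∃ C : ℝ, 0 < C ∧ ∀ x ∈ E, ∀ y ∈ E,
      C⁻¹ * dist x y ^ b ≤ dist (radialStretch a x) (radialStretch a y) ∧
      dist (radialStretch a x) (radialStretch a y) ≤ C * dist x y ^ a := by
  obtain ⟨R, hR, hER⟩ := hE.exists_pos_norm_le
  set c := a * R ^ (a - 1)
  have hc : 0 < c := by positivity
  set K := (2 * R) ^ (b - 1) / c with hK
  have hK0 : 0 < K := by positivity
  refine ⟨max 3 K, by positivity, fun x hx y hy => ?_⟩
  simp only [dist_eq_norm]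
  have hxR := hER x hx
  have hyR := hER y hy
  constructor
  · rw [inv_mul_le_iff₀ (by positivity)]
    have hlow := mul_norm_sub_le_norm_radialStretch_sub ha ha1 hR hxR hyR
    have hd : ‖x - y‖ ≤ 2 * R := (norm_sub_le x y).trans (by linarith)
    have hb0 : 0 ≤ b - 1 := by linarith
    calc ‖x - y‖ ^ b = ‖x - y‖ ^ (b - 1) * ‖x - y‖ :=
          (rpow_sub_one_mul_self (by linarith) (norm_nonneg _)).symm
      _ ≤ (2 * R) ^ (b - 1) * ‖x - y‖ := by gcongr
      _ = K * (c * ‖x - y‖) := by rw [hK]; field_simp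
      _ ≤ max 3 K * ‖radialStretch a x - radialStretch a y‖ := by
        gcongr
        exact le_max_right _ _
  · refine (norm_radialStretch_sub_le ha ha1 x y).trans ?_
    gcongr
    exact le_max_left _ _

end RadialStretch

lemma norm_spiralShell_point (ρ u v : ℝ) (hρ : 0 ≤ ρ) :
    ‖((WithLp.equiv 2 (Fin 3 → ℝ)).symm
      ![ρ * Real.cos u * Real.sin v, ρ * Real.sin u * Real.sin v, ρ * Real.cos v] : Euc 3)‖ =
      ρ := by
  rw [EuclideanSpace.norm_eq, Real.sqrt_eq_iff_mul_self_eq (by positivity) hρ]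
  simp only [WithLp.equiv_symm_apply, Fin.sum_univ_three, Real.norm_eq_abs, sq_abs,
    Matrix.cons_val]
  linear_combination ρ ^ 2 * Real.sin_sq_add_cos_sq v +
    ρ ^ 2 * Real.sin v ^ 2 * Real.sin_sq_add_cos_sq u

lemma radialStretch_spiralShell_point {p q u : ℝ} (hp : p ≠ 0) (hu : 0 < u) (v : ℝ) :
    radialStretch (q / p) ((WithLp.equiv 2 (Fin 3 → ℝ)).symm
      ![u ^ (-p) * Real.cos u * Real.sin v, u ^ (-p) * Real.sin u * Real.sin v,
        u ^ (-p) * Real.cos v] : Euc 3) =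
      (WithLp.equiv 2 (Fin 3 → ℝ)).symm
        ![u ^ (-q) * Real.cos u * Real.sin v, u ^ (-q) * Real.sin u * Real.sin v,
          u ^ (-q) * Real.cos v] := by
  have h : (u ^ (-p)) ^ (q / p - 1) * u ^ (-p) = u ^ (-q) := by
    rw [← Real.rpow_mul hu.le, ← Real.rpow_add hu]
    congr 1
    field_simp
    ring
  rw [radialStretch, norm_spiralShell_point _ _ _ (by positivity), ← h]
  ext i
  fin_cases i <;> simp [mul_assoc]

lemma radialStretch_image_spiralShell {p q : ℝ} (hp : p ≠ 0) :
    radialStretch (q / p) '' spiralShell p = spiralShell q := by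
  ext y
  constructor
  · rintro ⟨_, ⟨u, v, hu, hv, rfl⟩, rfl⟩
    exact ⟨u, v, hu, hv, radialStretch_spiralShell_point hp (by linarith) v⟩
  · rintro ⟨u, v, hu, hv, rfl⟩
    exact ⟨_, ⟨u, v, hu, hv, rfl⟩, radialStretch_spiralShell_point hp (by linarith) v⟩

/-- **Theorem (bi-Hölder equivalence of polynomial spiral shells).**
For `p ≥ q > 0` there is a homeomorphism `F : ℝ³ → ℝ³` with
`F(𝒮_p ∪ {0}) = 𝒮_q ∪ {0}` which is `(q/p, p/q)`-bi-Hölder on every compact set;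
in particular the radial stretch `F x = |x|^{q/p-1} x`, `F 0 = 0`, has these properties. -/
theorem biHolder_shell_map (p q : ℝ) (hq : 0 < q) (hpq : q ≤ p) :
    ∃ F : Euc 3 ≃ₜ Euc 3, (∀ x : Euc 3, F x = ‖x‖ ^ (q / p - 1) • x) ∧
      ⇑F '' (spiralShell p ∪ {0}) = spiralShell q ∪ {0} ∧
      ∀ E : Set (Euc 3), IsCompact E → ∃ C : ℝ, 0 < C ∧
        ∀ x ∈ E, ∀ y ∈ E,
          C⁻¹ * dist x y ^ (p / q) ≤ dist (F x) (F y) ∧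
          dist (F x) (F y) ≤ C * dist x y ^ (q / p) := by
  have hp : 0 < p := hq.trans_le hpq
  refine ⟨radialStretchHomeomorph (q / p) (div_pos hq hp), fun _ => rfl, ?_, fun E hE =>
    exists_biHolder_radialStretch (div_pos hq hp) ((div_le_one hp).2 hpq)
      ((one_le_div hq).2 hpq) hE.isBounded⟩
  change radialStretch (q / p) '' _ = _
  rw [image_union, radialStretch_image_spiralShell hp.ne', image_singleton]
  simp [radialStretch]
end
end

section
/- Let d ≥ 2, let S₀ = f(S(0,1)) ⊆ ℝ^d be a topological sphere for a homeomorphism f: ℝ^d → ℝ^d, and let x₀ be a point of the open set f(B(0,1)). Then there exist a sequence {g_n} of contracting similarity maps of ℝ^d and a strictly decreasing sequence a_n → 0 such that the union ⋃_{n≥0} g_n(S₀) (with g₀ the identity) is a concentric sphere collection centered at x₀ generated by S₀; that is, every topological sphere can be shrunk into any interior point of its topological ball by similarities satisfying the concentric sphere collection conditions. -/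
open Metric Set Filter MeasureTheory Topology
open scoped RealInnerProductSpace

noncomputable section

open scoped Pointwise in
/-- Scaling both sets about `x₀` by the factor `c` multiplies their distance by `c`. -/
theorem setDistance_image_homothety {d : ℕ} (x₀ : Euc d) {c : ℝ} (hc : 0 ≤ c)
    (A B : Set (Euc d)) :
    setDistance (AffineMap.homothety x₀ c '' A) (AffineMap.homothety x₀ c '' B) =
      c * setDistance A B := by
  have h : Set.image2 dist (AffineMap.homothety x₀ c '' A) (AffineMap.homothety x₀ c '' B) =
      c • Set.image2 dist A B := by
    rw [Set.image2_image_left, Set.image2_image_right, ← Set.image_smul, Set.image_image2]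
    refine Set.image2_congr fun x _ y _ => ?_
    simp [AffineMap.homothety_apply, dist_smul₀, abs_of_nonneg hc]
  rw [setDistance, h, Real.sInf_smul_of_nonneg hc, smul_eq_mul, setDistance]

/-- The Hausdorff distance from `A` to a point is the distance to a farthest point of `A`. -/
theorem hausdorffDist_singleton_eq {X : Type*} [MetricSpace X] {A : Set X} {x₀ x : X} (hx : x ∈ A)
    (hmax : ∀ y ∈ A, dist y x₀ ≤ dist x x₀) : hausdorffDist A {x₀} = dist x x₀ := by
  apply le_antisymm
  · refine hausdorffDist_le_of_mem_dist dist_nonneg (fun y hy => ⟨x₀, rfl, hmax y hy⟩) ?_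
    rintro _ rfl
    exact ⟨x, hx, (dist_comm _ _).le⟩
  · have hA : Bornology.IsBounded A :=
      isBounded_closedBall.subset fun y hy => mem_closedBall.2 (hmax y hy)
    have h := infDist_le_hausdorffDist_of_mem hx
      (hausdorffEDist_ne_top_of_nonempty_of_bounded ⟨x, hx⟩ (singleton_nonempty x₀) hA
        Bornology.isBounded_singleton)
    rwa [infDist_singleton] at h

/-- A homothety with positive ratio is a similarity. -/
theorem isSimilarityRatio_homothety {d : ℕ} (x₀ : Euc d) {c : ℝ} (hc : 0 < c) :
    IsSimilarityRatio (AffineMap.homothety x₀ c : Euc d → Euc d) c := by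
  refine ⟨hc, LinearIsometryEquiv.refl ℝ _, x₀ - c • x₀, fun x => ?_⟩
  simp only [AffineMap.homothety_apply, vsub_eq_sub, vadd_eq_add, LinearIsometryEquiv.coe_refl,
    id_eq]
  module

/-- **Proposition (every topological sphere can be shrunk into an interior point).**
Given a topological sphere `S₀ = f(S(0,1)) ⊆ ℝ^d` and a point `x₀ ∈ f(B(0,1))`, there are
contracting similarities `g_n` (with `g₀ = id`) and a strictly decreasing null sequence
`a_n` realizing `⋃_n g_n(S₀)` as a concentric sphere collection centered at `x₀`
generated by `S₀`. -/
theorem exists_concentric_sphere_collection (d : ℕ) (hd : 2 ≤ d)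
    (f : Euc d ≃ₜ Euc d) (S₀ : Set (Euc d)) (hS₀ : S₀ = f '' sphere (0 : Euc d) 1)
    (x₀ : Euc d) (hx₀ : x₀ ∈ f '' ball (0 : Euc d) 1) :
    ∃ g : ℕ → Euc d → Euc d, ∃ a : ℕ → ℝ, ∃ c₁ c₂ : ℝ, ∃ n₀ : ℕ,
      g 0 = id ∧
      (∀ n : ℕ, 1 ≤ n → ∃ c : ℝ, c < 1 ∧ IsSimilarityRatio (g n) c) ∧
      c₁ ∈ Ioc (0 : ℝ) 1 ∧ c₂ ∈ Ioc (0 : ℝ) 1 ∧ 1 ≤ n₀ ∧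
      StrictAnti a ∧ Tendsto a atTop (𝓝 (0 : ℝ)) ∧
      (∀ n : ℕ, n₀ ≤ n →
        hausdorffDist (g n '' S₀) {x₀} = c₁ * a n ∧
        setDistance (g n '' S₀) (g (n + 1) '' S₀) = c₂ * (a n - a (n + 1))) := by
  have hne : S₀.Nonempty := by
    have : Nonempty (Fin d) := ⟨⟨0, by omega⟩⟩
    rw [hS₀]
    exact (NormedSpace.sphere_nonempty.2 zero_le_one).image f
  have hcpt : IsCompact S₀ := hS₀ ▸ (isCompact_sphere 0 1).image f.continuous
  have hx₀S : x₀ ∉ S₀ := by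
    rw [hS₀]
    rintro ⟨y, hy, rfl⟩
    obtain ⟨z, hz, hzy⟩ := hx₀
    rw [f.injective hzy] at hz
    exact (mem_ball.1 hz).ne (mem_sphere.1 hy)
  have hcont : ContinuousOn (fun x => dist x x₀) S₀ := by fun_prop
  obtain ⟨p, hp, hpmax⟩ := hcpt.exists_isMaxOn hne hcont
  obtain ⟨q, hq, hqmin⟩ := hcpt.exists_isMinOn hne hcont
  have hmax : ∀ y ∈ S₀, dist y x₀ ≤ dist p x₀ := fun y hy => hpmax hy
  have hmin : ∀ y ∈ S₀, dist q x₀ ≤ dist y x₀ := fun y hy => hqmin hy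
  have hr : 0 < dist q x₀ := dist_pos.2 fun h => hx₀S (h ▸ hq)
  have hrR : dist q x₀ ≤ dist p x₀ := hmax q hq
  have hR : 0 < dist p x₀ := hr.trans_le hrR
  set r := dist q x₀
  set R := dist p x₀ with hRdef
  obtain ⟨l, hl⟩ : ∃ l, l = r / (2 * R) := ⟨_, rfl⟩
  have hl0 : 0 < l := by rw [hl]; positivity
  have hlR : l * R = r / 2 := by rw [hl]; field_simp
  have hl1 : l < 1 := by nlinarith
  set D := setDistance S₀ (AffineMap.homothety x₀ l '' S₀) with hD
  have hdist (c : ℝ) (hc : 0 ≤ c) (y : Euc d) :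
      dist (AffineMap.homothety x₀ c y) x₀ = c * dist y x₀ := by
    rw [dist_homothety_center, Real.norm_of_nonneg hc, dist_comm]
  have hlow : ∀ t ∈ Set.image2 dist S₀ (AffineMap.homothety x₀ l '' S₀), r / 2 ≤ t := by
    rintro _ ⟨x, hx, _, ⟨y, hy, rfl⟩, rfl⟩
    have h := dist_triangle x (AffineMap.homothety x₀ l y) x₀
    rw [hdist l hl0.le] at h
    have := mul_le_mul_of_nonneg_left (hmax y hy) hl0.le
    linarith [hmin x hx]
  have hD0 : 0 < D :=
    (half_pos hr).trans_le (le_csInf (hne.image2 (hne.image _)) hlow)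
  have hDR : D ≤ R * (1 - l) := by
    refine (csInf_le ⟨r / 2, hlow⟩ (mem_image2_of_mem hp (mem_image_of_mem _ hp))).trans_eq ?_
    rw [dist_self_homothety, Real.norm_of_nonneg (by linarith), dist_comm, mul_comm]
  have hRl : 0 < R * (1 - l) := mul_pos hR (by linarith)
  refine ⟨fun n => AffineMap.homothety x₀ (l ^ n), fun n => R * l ^ n, 1, D / (R * (1 - l)), 1,
    ?_, fun n hn => ⟨l ^ n, pow_lt_one₀ hl0.le hl1 (by omega),
      isSimilarityRatio_homothety x₀ (by positivity)⟩, by simp,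
    ⟨by positivity, (div_le_one hRl).2 hDR⟩, le_rfl,
    (pow_right_strictAnti₀ hl0 hl1).const_mul hR, ?_, fun n _ => ⟨?_, ?_⟩⟩
  · ext1 x
    simp
  · simpa using (tendsto_pow_atTop_nhds_zero_of_lt_one hl0.le hl1).const_mul R
  · have hn : 0 ≤ l ^ n := by positivity
    rw [hausdorffDist_singleton_eq (mem_image_of_mem _ hp), hdist _ hn]
    · ring
    · rintro _ ⟨y, hy, rfl⟩
      rw [hdist _ hn, hdist _ hn]
      exact mul_le_mul_of_nonneg_left (hmax y hy) hn
  · have himg : AffineMap.homothety x₀ (l ^ (n + 1)) '' S₀ =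
        AffineMap.homothety x₀ (l ^ n) '' (AffineMap.homothety x₀ l '' S₀) := by
      rw [pow_succ, AffineMap.homothety_mul, AffineMap.coe_comp, image_comp]
    dsimp only
    rw [himg, setDistance_image_homothety x₀ (by positivity), ← hD]
    have : 1 - l ≠ 0 := by linarith
    field_simp
    ring
end
end
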